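/- Let p ∈ (0,1) and let (G_t)_{t≥1} be the preferential attachment process with edge-steps with parameter p. Define γ(p) := 2 − p − 3(1−p)/(2−p). Then for every ε with 0 < ε < 1 there exist positive constants C₁ and C₂, depending only on ε and p, such that P( C₁ · t^{−γ(p)(1+ε)} ≤ τ(G_t) ≤ C₂ · t^{−γ(p)(1−ε)} ) = 1 − o(1) as t → ∞, where τ(G_t) is the global clustering coefficient of G_t. -/

import Mathlib

open MeasureTheory Filter

attribute [local instance] Classical.propDecidable

/-- Degree of vertex `i` at time `t` computed from the endpoint process `ep`:
the edge added at step `s` contributes `1` for each of its endpoints equal to `i`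
(so a loop at `i` contributes `2`). -/
noncomputable def degOf {Ω : Type} (ep : ℕ → Ω → ℕ × ℕ) (t i : ℕ) (ω : Ω) : ℕ :=
  ∑ s ∈ Finset.Icc 1 t,
    ((if (ep s ω).1 = i then 1 else 0) + (if (ep s ω).2 = i then 1 else 0))

/-- The preferential attachment random graph process with edge-steps and parameter `p`.
`G_1` is a single vertex (labeled `1`) with a loop.  At each step `t + 1` (for `t ≥ 1`),
with probability `p` a vertex-step occurs: a new vertex `nv t + 1` is added together with an
edge to an old vertex `u`, chosen with probability `d_t(u) / (2t)`; with probability `1 - p`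
an edge-step occurs: an edge `{u, w}` is added, where `u` and `w` are chosen independently,
each with probability proportional to its degree.  The field `ep t` records the (ordered pair
of) endpoints of the unique edge added at step `t`, `nv t` is the number of vertices of `G_t`,
and `Z t` tells whether step `t` was a vertex-step.  The one-step conditional laws are
prescribed via conditional expectations with respect to a filtration `ℱ` to which the process
is adapted. -/
structure PAProcess (p : ℝ) where
  Ω : Type
  m0 : MeasurableSpace Ω
  μ : Measure Ω
  isProb : IsProbabilityMeasure μ
  ℱ : Filtration ℕ m0
  Z : ℕ → Ω → Bool
  nv : ℕ → Ω → ℕ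
  ep : ℕ → Ω → ℕ × ℕ
  nv_one : ∀ ω, nv 1 ω = 1
  ep_one : ∀ ω, ep 1 ω = (1, 1)
  nv_succ : ∀ t, 1 ≤ t → ∀ ω, nv (t + 1) ω = nv t ω + (if Z (t + 1) ω then 1 else 0)
  ep_vertexStep : ∀ t, 1 ≤ t → ∀ ω, Z (t + 1) ω = true →
    (ep (t + 1) ω).2 = nv t ω + 1 ∧ 1 ≤ (ep (t + 1) ω).1 ∧ (ep (t + 1) ω).1 ≤ nv t ω
  ep_edgeStep : ∀ t, 1 ≤ t → ∀ ω, Z (t + 1) ω = false →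
    1 ≤ (ep (t + 1) ω).1 ∧ (ep (t + 1) ω).1 ≤ nv t ω ∧
    1 ≤ (ep (t + 1) ω).2 ∧ (ep (t + 1) ω).2 ≤ nv t ω
  Z_meas : ∀ t, Measurable[ℱ t] (Z t)
  nv_meas : ∀ t, Measurable[ℱ t] (nv t)
  ep_meas : ∀ t, Measurable[ℱ t] (ep t)
  condLaw_Z : ∀ t, 1 ≤ t →
    μ[Set.indicator {ω | Z (t + 1) ω = true} (fun _ => (1 : ℝ)) | ℱ t] =ᵐ[μ] fun _ => p
  condLaw_vertex : ∀ t, 1 ≤ t → ∀ u,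
    μ[Set.indicator {ω | Z (t + 1) ω = true ∧ ep (t + 1) ω = (u, nv t ω + 1)}
        (fun _ => (1 : ℝ)) | ℱ t]
      =ᵐ[μ] fun ω => p * (degOf ep t u ω : ℝ) / (2 * t)
  condLaw_edge : ∀ t, 1 ≤ t → ∀ u w,
    μ[Set.indicator {ω | Z (t + 1) ω = false ∧ ep (t + 1) ω = (u, w)}
        (fun _ => (1 : ℝ)) | ℱ t]
      =ᵐ[μ] fun ω => (1 - p) * (degOf ep t u ω : ℝ) * (degOf ep t w ω : ℝ) / (2 * t) ^ 2

namespace PAProcess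

variable {p : ℝ} (P : PAProcess p)

/-- degree `d_t(i)` of vertex `i` in `G_t` (`0` if `i` is not yet present). -/
noncomputable def deg (t i : ℕ) (ω : P.Ω) : ℕ := degOf P.ep t i ω

/-- `i` and `j` are joined by at least one edge in `G_t`. -/
def Joined (t i j : ℕ) (ω : P.Ω) : Prop :=
  ∃ s ∈ Finset.Icc 1 t, P.ep s ω = (i, j) ∨ P.ep s ω = (j, i)

/-- number of triangles of `G_t`: sets of three distinct vertices pairwise joined by at
least one edge (counted without edge multiplicities). -/
noncomputable def triangles (t : ℕ) (ω : P.Ω) : ℕ :=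
  ((Finset.Icc 1 t ×ˢ Finset.Icc 1 t ×ˢ Finset.Icc 1 t).filter
    (fun q => q.1 < q.2.1 ∧ q.2.1 < q.2.2 ∧ P.Joined t q.1 q.2.1 ω ∧
      P.Joined t q.1 q.2.2 ω ∧ P.Joined t q.2.1 q.2.2 ω)).card

/-- number of cherries (paths of length 2) of `G_t`: unordered pairs of distinct edges of
`G_t` sharing a common endpoint.  The edges of `G_t` are indexed by their creation times
`1 ≤ s ≤ t`. -/
noncomputable def cherries (t : ℕ) (ω : P.Ω) : ℕ :=
  ((Finset.Icc 1 t ×ˢ Finset.Icc 1 t).filter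
    (fun q => q.1 < q.2 ∧
      ((P.ep q.1 ω).1 = (P.ep q.2 ω).1 ∨ (P.ep q.1 ω).1 = (P.ep q.2 ω).2 ∨
       (P.ep q.1 ω).2 = (P.ep q.2 ω).1 ∨ (P.ep q.1 ω).2 = (P.ep q.2 ω).2))).card

/-- global clustering coefficient of `G_t`. -/
noncomputable def clustering (t : ℕ) (ω : P.Ω) : ℝ :=
  3 * (P.triangles t ω : ℝ) / (P.cherries t ω : ℝ)

/-- clique number of `G_t`: the largest `k` such that `G_t` contains `k` distinct vertices
pairwise joined by at least one edge. -/
noncomputable def cliqueNum (t : ℕ) (ω : P.Ω) : ℕ :=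
  sSup {k | ∃ S : Finset ℕ, S ⊆ Finset.Icc 1 (P.nv t ω) ∧ S.card = k ∧
    ∀ i ∈ S, ∀ j ∈ S, i ≠ j → P.Joined t i j ω}

/-- `Γ_t(j)`: the number of distinct vertices joined to `j` by at least one edge in `G_t`. -/
noncomputable def nbrCount (t j : ℕ) (ω : P.Ω) : ℕ :=
  ((Finset.Icc 1 t).filter (fun i => P.Joined t i j ω)).card

/-- the time at which vertex `j` is added to the graph. -/
noncomputable def addTime (j : ℕ) (ω : P.Ω) : ℕ := sInf {t | P.nv t ω = j}

/-- at step `s` an edge joining `i` and `j` is added by an edge-step. -/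
def EdgeStepEdge (s i j : ℕ) (ω : P.Ω) : Prop :=
  2 ≤ s ∧ P.Z s ω = false ∧ (P.ep s ω = (i, j) ∨ P.ep s ω = (j, i))

/-- at step `s` an edge joining `i` and `j` is added by a vertex-step. -/
def VertexStepEdge (s i j : ℕ) (ω : P.Ω) : Prop :=
  2 ≤ s ∧ P.Z s ω = true ∧ (P.ep s ω = (i, j) ∨ P.ep s ω = (j, i))

/-- at step `s` vertex `j` is added by a vertex-step and its attaching edge connects it
to vertex `i`. -/
def AttachEdge (s i j : ℕ) (ω : P.Ω) : Prop :=
  2 ≤ s ∧ P.Z s ω = true ∧ P.ep s ω = (i, j) ∧ P.nv s ω = j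

/-- `i` and `j` are joined in `G_t` by at least one edge created at an edge-step. -/
def EdgeJoined (t i j : ℕ) (ω : P.Ω) : Prop :=
  ∃ s ∈ Finset.Icc 1 t, P.EdgeStepEdge s i j ω

/-- `i` and `j` are joined in `G_t` by at least one edge created at a vertex-step. -/
def VJoined (t i j : ℕ) (ω : P.Ω) : Prop :=
  ∃ s ∈ Finset.Icc 1 t, P.VertexStepEdge s i j ω

/-- `i` and `j` are joined in `G_t`, and exclusively by edges created at vertex-steps. -/
def OnlyVertexJoined (t i j : ℕ) (ω : P.Ω) : Prop :=
  P.Joined t i j ω ∧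
    ∀ s ∈ Finset.Icc 1 t, (P.ep s ω = (i, j) ∨ P.ep s ω = (j, i)) → P.Z s ω = true

end PAProcess

namespace PAProcess

variable {p : ℝ} (P : PAProcess p)

attribute [local instance] PAProcess.m0 PAProcess.isProb

theorem deg_succ (t i : ℕ) (ω : P.Ω) :
    P.deg (t + 1) i ω = P.deg t i ω +
      ((if (P.ep (t + 1) ω).1 = i then 1 else 0) + (if (P.ep (t + 1) ω).2 = i then 1 else 0)) := by
  simp only [deg, degOf]
  rw [Finset.sum_Icc_succ_top (by omega)]

theorem deg_one (i : ℕ) (ω : P.Ω) : P.deg 1 i ω = if i = 1 then 2 else 0 := by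
  simp only [deg, degOf, Finset.Icc_self, Finset.sum_singleton, P.ep_one]
  by_cases h : i = 1
  · simp [h]
  · simp [h, Ne.symm h]

theorem deg_mono (i : ℕ) (ω : P.Ω) : Monotone fun t => P.deg t i ω :=
  monotone_nat_of_le_succ fun t => by rw [P.deg_succ]; omega

theorem nv_le_succ {t : ℕ} (ht : 1 ≤ t) (ω : P.Ω) : P.nv t ω ≤ P.nv (t + 1) ω := by
  rw [P.nv_succ t ht]; omega

theorem nv_mono {s t : ℕ} (hs : 1 ≤ s) (hst : s ≤ t) (ω : P.Ω) : P.nv s ω ≤ P.nv t ω := by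
  induction t, hst using Nat.le_induction with
  | base => rfl
  | succ t hst ih => exact ih.trans (P.nv_le_succ (hs.trans hst) ω)

theorem nv_le {t : ℕ} (ht : 1 ≤ t) (ω : P.Ω) : P.nv t ω ≤ t := by
  induction t, ht using Nat.le_induction with
  | base => simp [P.nv_one]
  | succ t ht ih => rw [P.nv_succ t ht]; split_ifs <;> omega

theorem ep_mem {t : ℕ} (ht : 1 ≤ t) (ω : P.Ω) :
    (1 ≤ (P.ep t ω).1 ∧ (P.ep t ω).1 ≤ P.nv t ω) ∧
      (1 ≤ (P.ep t ω).2 ∧ (P.ep t ω).2 ≤ P.nv t ω) := by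
  obtain rfl | ⟨s, rfl, hs⟩ : t = 1 ∨ ∃ s, t = s + 1 ∧ 1 ≤ s := by
    rcases Nat.lt_or_ge 1 t with h | h
    · exact .inr ⟨t - 1, by omega, by omega⟩
    · exact .inl (by omega)
  · simp [P.ep_one, P.nv_one]
  · have hn := P.nv_succ s hs ω
    cases hZ : P.Z (s + 1) ω with
    | true =>
      have := P.ep_vertexStep s hs ω hZ
      simp only [hZ, if_true] at hn
      omega
    | false =>
      have := P.ep_edgeStep s hs ω hZ
      simp only [hZ] at hn
      simp at hn
      omega

theorem deg_eq_zero {t i : ℕ} (ω : P.Ω) (hi : i = 0 ∨ P.nv t ω < i) :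
    P.deg t i ω = 0 := by
  simp only [deg, degOf]
  refine Finset.sum_eq_zero fun s hs => ?_
  rw [Finset.mem_Icc] at hs
  have h1 := P.ep_mem hs.1 ω
  have h2 := P.nv_mono hs.1 hs.2 ω
  rw [if_neg (by omega), if_neg (by omega), add_zero]

theorem deg_eq_zero_of_lt {t i : ℕ} (ht : 1 ≤ t) (ω : P.Ω) (hi : t < i) : P.deg t i ω = 0 :=
  P.deg_eq_zero ω (.inr ((P.nv_le ht ω).trans_lt hi))

theorem deg_le (t i : ℕ) (ω : P.Ω) : P.deg t i ω ≤ 2 * t := by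
  induction t with
  | zero => simp [deg, degOf]
  | succ t ih => rw [P.deg_succ]; split_ifs <;> omega

theorem one_le_deg {t i : ℕ} (ht : 1 ≤ t) (ω : P.Ω) (h1 : 1 ≤ i) (hi : i ≤ P.nv t ω) :
    1 ≤ P.deg t i ω := by
  induction t, ht using Nat.le_induction with
  | base =>
    rw [P.nv_one] at hi
    obtain rfl : i = 1 := by omega
    simp [P.deg_one]
  | succ t ht ih =>
    rw [P.deg_succ]
    by_cases h : i ≤ P.nv t ω
    · have := ih h; omega
    · have hn := P.nv_succ t ht ω
      cases hZ : P.Z (t + 1) ω with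
      | true =>
        have := P.ep_vertexStep t ht ω hZ
        simp only [hZ, if_true] at hn
        rw [if_pos (show (P.ep (t + 1) ω).2 = i by omega)]
        omega
      | false => simp [hZ] at hn; omega

theorem sum_deg (t : ℕ) (ω : P.Ω) :
    ∑ i ∈ Finset.range (t + 1), P.deg t i ω = 2 * t := by
  simp only [deg, degOf]
  rw [Finset.sum_comm]
  rw [Finset.sum_congr rfl (g := fun _ => 2)]
  · simp [mul_comm]
  intro s hs
  rw [Finset.mem_Icc] at hs
  have h1 := P.ep_mem hs.1 ω
  have h2 := P.nv_le hs.1 ω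
  rw [Finset.sum_add_distrib, Finset.sum_ite_eq, Finset.sum_ite_eq,
    if_pos (by simp; omega), if_pos (by simp; omega)]

theorem measurable_deg {t : ℕ} {u : P.Ω → ℕ} (hu : Measurable[P.ℱ t] u) :
    Measurable[P.ℱ t] fun ω => P.deg t (u ω) ω := by
  simp only [deg, degOf]
  refine @Finset.measurable_sum _ _ _ _ _ _ (P.ℱ t) _ _ fun s hs => ?_
  have hs' := (P.ep_meas s).mono (P.ℱ.mono (Finset.mem_Icc.1 hs).2) le_rfl
  refine Measurable.add (Measurable.ite ?_ measurable_const measurable_const)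
    (Measurable.ite ?_ measurable_const measurable_const)
  · exact measurableSet_eq_fun (measurable_fst.comp hs') hu
  · exact measurableSet_eq_fun (measurable_snd.comp hs') hu

/-- The `0`-`1` real-valued indicator of a proposition. -/
noncomputable def ind (A : Prop) : ℝ := if A then 1 else 0

theorem ind_pos {A : Prop} (h : A) : ind A = 1 := if_pos h

theorem ind_neg {A : Prop} (h : ¬A) : ind A = 0 := if_neg h

theorem ind_nonneg (A : Prop) : 0 ≤ ind A := by unfold ind; split_ifs <;> simp

theorem ind_le_one (A : Prop) : ind A ≤ 1 := by unfold ind; split_ifs <;> simp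

theorem ind_mono {A B : Prop} (h : A → B) : ind A ≤ ind B := by
  by_cases hA : A
  · rw [ind_pos hA, ind_pos (h hA)]
  · rw [ind_neg hA]; exact ind_nonneg B

theorem ind_and (A B : Prop) : ind (A ∧ B) = ind A * ind B := by
  by_cases hA : A <;> by_cases hB : B <;> simp [ind, hA, hB]

/-- Bounded real random variables measurable with respect to the past `ℱ t`. -/
def Weight (t : ℕ) (W : P.Ω → ℝ) : Prop :=
  Measurable[P.ℱ t] W ∧ ∃ K, ∀ ω, |W ω| ≤ K

namespace Weight

variable {P} {t : ℕ} {V W : P.Ω → ℝ}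

theorem const (c : ℝ) : P.Weight t fun _ => c :=
  ⟨measurable_const, |c|, fun _ => le_rfl⟩

theorem mul (hV : P.Weight t V) (hW : P.Weight t W) : P.Weight t fun ω => V ω * W ω := by
  obtain ⟨hV, K, hK⟩ := hV
  obtain ⟨hW, L, hL⟩ := hW
  refine ⟨hV.mul hW, K * L, fun ω => ?_⟩
  rw [abs_mul]
  exact mul_le_mul (hK ω) (hL ω) (abs_nonneg _) ((abs_nonneg _).trans (hK ω))

theorem add (hV : P.Weight t V) (hW : P.Weight t W) : P.Weight t fun ω => V ω + W ω := by
  obtain ⟨hV, K, hK⟩ := hV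
  obtain ⟨hW, L, hL⟩ := hW
  exact ⟨hV.add hW, K + L, fun ω => (abs_add_le _ _).trans (add_le_add (hK ω) (hL ω))⟩

theorem ind_event {A : P.Ω → Prop} (hA : MeasurableSet[P.ℱ t] {ω | A ω}) :
    P.Weight t fun ω => ind (A ω) :=
  ⟨Measurable.ite hA measurable_const measurable_const, 1, fun ω => by
    rw [abs_of_nonneg (ind_nonneg _)]; exact ind_le_one _⟩

theorem mono {s : ℕ} (hst : s ≤ t) (hW : P.Weight s W) : P.Weight t W :=
  ⟨hW.1.mono (P.ℱ.mono hst) le_rfl, hW.2⟩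

theorem integrable (hW : P.Weight t W) : Integrable W P.μ := by
  obtain ⟨hW, K, hK⟩ := hW
  exact Integrable.of_bound (hW.mono (P.ℱ.le t) le_rfl).aestronglyMeasurable K
    (Eventually.of_forall hK)

theorem comp_deg (f : ℕ → ℝ) {u : P.Ω → ℕ} (hu : Measurable[P.ℱ t] u) :
    P.Weight t fun ω => f (P.deg t (u ω) ω) := by
  refine ⟨(measurable_from_nat (f := f)).comp (P.measurable_deg hu),
    ∑ d ∈ Finset.range (2 * t + 1), |f d|, fun ω => ?_⟩
  exact Finset.single_le_sum (f := fun d => |f d|) (fun _ _ => abs_nonneg _)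
    (Finset.mem_range.2 (Nat.lt_succ_of_le (P.deg_le t _ ω)))

end Weight

theorem measurableSet_ep_eq {t : ℕ} {u v : P.Ω → ℕ} (hu : Measurable[P.ℱ t] u)
    (hv : Measurable[P.ℱ t] v) : MeasurableSet[P.ℱ t] {ω | P.ep t ω = (u ω, v ω)} :=
  measurableSet_eq_fun (P.ep_meas t) (hu.prodMk hv)

theorem measurableSet_Z (t : ℕ) (b : Bool) : MeasurableSet[P.ℱ t] {ω | P.Z t ω = b} :=
  P.Z_meas t (MeasurableSet.singleton b)

theorem integral_mul_ind {t : ℕ} {W q : P.Ω → ℝ} (hW : P.Weight t W) {A : P.Ω → Prop}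
    (hA : MeasurableSet {ω | A ω})
    (hq : P.μ[Set.indicator {ω | A ω} (fun _ => (1 : ℝ)) | P.ℱ t] =ᵐ[P.μ] q) :
    ∫ ω, W ω * ind (A ω) ∂P.μ = ∫ ω, W ω * q ω ∂P.μ := by
  have hI : Integrable (Set.indicator {ω | A ω} (fun _ => (1 : ℝ))) P.μ :=
    (integrable_const 1).indicator hA
  obtain ⟨hWm, K, hK⟩ := hW
  have hpull := condExp_stronglyMeasurable_mul_of_bound (P.ℱ.le t) hWm.stronglyMeasurable hI K
    (Eventually.of_forall hK)
  calc ∫ ω, W ω * ind (A ω) ∂P.μ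
      = ∫ ω, (W * Set.indicator {ω | A ω} (fun _ => (1 : ℝ))) ω ∂P.μ := by
        simp [Set.indicator_apply, ind]
    _ = ∫ ω, (P.μ[W * Set.indicator {ω | A ω} (fun _ => (1 : ℝ)) | P.ℱ t]) ω ∂P.μ :=
        (integral_condExp (P.ℱ.le t)).symm
    _ = ∫ ω, W ω * q ω ∂P.μ := by
        refine integral_congr_ae ?_
        filter_upwards [hpull, hq] with ω h1 h2
        rw [h1, Pi.mul_apply, h2]

theorem sum_sum_ind_mul {n u v : ℕ} (x : ℝ) (F : ℕ → ℕ → ℝ)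
    (hF : ∀ i j, n < i ∨ n < j → F i j = 0) :
    ∑ i ∈ Finset.range (n + 1), ∑ j ∈ Finset.range (n + 1),
      x * (ind (u = i) * ind (v = j)) * F i j = x * F u v := by
  simp only [ind, mul_ite, ite_mul, mul_one, mul_zero, zero_mul]
  by_cases h : n < u ∨ n < v
  · rw [hF u v h, mul_zero]
    refine Finset.sum_eq_zero fun i hi => Finset.sum_eq_zero fun j hj => ?_
    rw [Finset.mem_range] at hi hj
    split_ifs
    · omega
    · rfl
    · rfl
  · rw [Finset.sum_eq_single u, Finset.sum_eq_single v]
    · simp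
    · intro j _ hj; simp [Ne.symm hj]
    · intro hv; simp at hv; omega
    · intro i _ hi; simp [Ne.symm hi]
    · intro hv; simp at hv; omega

theorem measurableSet_edgeStep {t : ℕ} {u v : P.Ω → ℕ} (hu : Measurable[P.ℱ t] u)
    (hv : Measurable[P.ℱ t] v) :
    MeasurableSet[P.ℱ (t + 1)] {ω | P.Z (t + 1) ω = false ∧ P.ep (t + 1) ω = (u ω, v ω)} :=
  (P.measurableSet_Z (t + 1) false).inter
    (P.measurableSet_ep_eq (hu.mono (P.ℱ.mono (Nat.le_succ t)) le_rfl)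
      (hv.mono (P.ℱ.mono (Nat.le_succ t)) le_rfl))

theorem measurableSet_vertexStep {t : ℕ} {u : P.Ω → ℕ} (hu : Measurable[P.ℱ t] u) :
    MeasurableSet[P.ℱ (t + 1)]
      {ω | P.Z (t + 1) ω = true ∧ P.ep (t + 1) ω = (u ω, P.nv t ω + 1)} :=
  (P.measurableSet_Z (t + 1) true).inter
    (P.measurableSet_ep_eq (hu.mono (P.ℱ.mono (Nat.le_succ t)) le_rfl)
      (((P.nv_meas t).add_const 1).mono (P.ℱ.mono (Nat.le_succ t)) le_rfl))

theorem weight_ind_eq {t : ℕ} {u : P.Ω → ℕ} (hu : Measurable[P.ℱ t] u) (i : ℕ) :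
    P.Weight t fun ω => ind (u ω = i) :=
  Weight.ind_event (hu (MeasurableSet.singleton i))

theorem integral_edgeStep {t : ℕ} (ht : 1 ≤ t) {W : P.Ω → ℝ} (hW : P.Weight t W)
    {u v : P.Ω → ℕ} (hu : Measurable[P.ℱ t] u) (hv : Measurable[P.ℱ t] v) :
    ∫ ω, W ω * ind (P.Z (t + 1) ω = false ∧ P.ep (t + 1) ω = (u ω, v ω)) ∂P.μ =
      ∫ ω, W ω * ((1 - p) * P.deg t (u ω) ω * P.deg t (v ω) ω / (2 * t) ^ 2) ∂P.μ := by
  have hw : ∀ i j, P.Weight t fun ω =>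
      W ω * (ind (u ω = i) * ind (v ω = j)) := fun i j =>
    hW.mul ((P.weight_ind_eq hu i).mul (P.weight_ind_eq hv j))
  have hE : ∀ i j, MeasurableSet[P.ℱ (t + 1)]
      {ω | P.Z (t + 1) ω = false ∧ P.ep (t + 1) ω = (i, j)} := fun i j =>
    P.measurableSet_edgeStep measurable_const measurable_const
  have key : ∀ i j, _ := fun i j =>
    P.integral_mul_ind (hw i j) (P.ℱ.le _ _ (hE i j)) (P.condLaw_edge t ht i j)
  have h1 : ∀ ω, W ω * ind (P.Z (t + 1) ω = false ∧ P.ep (t + 1) ω = (u ω, v ω)) =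
      ∑ i ∈ Finset.range (t + 1), ∑ j ∈ Finset.range (t + 1),
        W ω * (ind (u ω = i) * ind (v ω = j)) *
        ind (P.Z (t + 1) ω = false ∧ P.ep (t + 1) ω = (i, j)) := fun ω => by
    refine (sum_sum_ind_mul (W ω) (fun i j =>
      ind (P.Z (t + 1) ω = false ∧ P.ep (t + 1) ω = (i, j))) ?_).symm
    intro i j hij
    refine ind_neg fun h => ?_
    have h1 := P.ep_edgeStep t ht ω h.1
    have h2 := P.nv_le ht ω
    rw [h.2] at h1
    simp only at h1
    omega
  have h2 : ∀ ω, W ω * ((1 - p) * P.deg t (u ω) ω * P.deg t (v ω) ω / (2 * t) ^ 2) =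
      ∑ i ∈ Finset.range (t + 1), ∑ j ∈ Finset.range (t + 1),
        W ω * (ind (u ω = i) * ind (v ω = j)) *
        ((1 - p) * (P.deg t i ω : ℝ) * (P.deg t j ω : ℝ) / (2 * t) ^ 2) := fun ω => by
    refine (sum_sum_ind_mul (W ω) (fun i j =>
      (1 - p) * (P.deg t i ω : ℝ) * (P.deg t j ω : ℝ) / (2 * t) ^ 2) ?_).symm
    rintro i j (hi | hj)
    · simp [P.deg_eq_zero_of_lt ht ω hi]
    · simp [P.deg_eq_zero_of_lt ht ω hj]
  simp only [h1, h2]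
  rw [integral_finsetSum, integral_finsetSum]
  · refine Finset.sum_congr rfl fun i _ => ?_
    rw [integral_finsetSum, integral_finsetSum]
    · exact Finset.sum_congr rfl fun j _ => key i j
    · exact fun j _ => ((hw i j).mul (((((Weight.const _).mul
        (Weight.comp_deg (fun d => (d : ℝ)) measurable_const)).mul
        (Weight.comp_deg (fun d => (d : ℝ)) measurable_const))).mul
        (Weight.const ((2 * t : ℝ) ^ 2)⁻¹))).integrable
    · exact fun j _ => (((hw i j).mono (Nat.le_succ t)).mul (Weight.ind_event (hE i j))).integrable
  · refine fun i _ => integrable_finsetSum _ fun j _ => ?_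
    exact ((hw i j).mul (((((Weight.const _).mul
        (Weight.comp_deg (fun d => (d : ℝ)) measurable_const)).mul
        (Weight.comp_deg (fun d => (d : ℝ)) measurable_const))).mul
        (Weight.const ((2 * t : ℝ) ^ 2)⁻¹))).integrable
  · refine fun i _ => integrable_finsetSum _ fun j _ => ?_
    exact (((hw i j).mono (Nat.le_succ t)).mul (Weight.ind_event (hE i j))).integrable

theorem integral_vertexStep {t : ℕ} (ht : 1 ≤ t) {W : P.Ω → ℝ} (hW : P.Weight t W)
    {u : P.Ω → ℕ} (hu : Measurable[P.ℱ t] u) :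
    ∫ ω, W ω * ind (P.Z (t + 1) ω = true ∧ P.ep (t + 1) ω = (u ω, P.nv t ω + 1))
      ∂P.μ = ∫ ω, W ω * (p * P.deg t (u ω) ω / (2 * t)) ∂P.μ := by
  have hw : ∀ i, P.Weight t fun ω => W ω * ind (u ω = i) := fun i =>
    hW.mul (P.weight_ind_eq hu i)
  have hE : ∀ i, MeasurableSet[P.ℱ (t + 1)]
      {ω | P.Z (t + 1) ω = true ∧ P.ep (t + 1) ω = (i, P.nv t ω + 1)} := fun i =>
    P.measurableSet_vertexStep measurable_const
  have key : ∀ i, _ := fun i =>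
    P.integral_mul_ind (hw i) (P.ℱ.le _ _ (hE i)) (P.condLaw_vertex t ht i)
  have h0 : ∀ (x : ℝ) (a : ℕ) (F : ℕ → ℝ), (∀ i, t < i → F i = 0) →
      ∑ i ∈ Finset.range (t + 1), x * ind (a = i) * F i = x * F a := by
    intro x a F hF
    simp only [ind, mul_ite, ite_mul, mul_one, mul_zero, zero_mul]
    rw [Finset.sum_ite_eq]
    split_ifs with h
    · rfl
    · rw [hF a (by simpa using h), mul_zero]
  have h1 : ∀ ω, W ω * ind (P.Z (t + 1) ω = true ∧ P.ep (t + 1) ω = (u ω, P.nv t ω + 1)) =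
      ∑ i ∈ Finset.range (t + 1), W ω * ind (u ω = i) *
        ind (P.Z (t + 1) ω = true ∧ P.ep (t + 1) ω = (i, P.nv t ω + 1)) := fun ω => by
    refine (h0 (W ω) (u ω) (fun i =>
      ind (P.Z (t + 1) ω = true ∧ P.ep (t + 1) ω = (i, P.nv t ω + 1))) ?_).symm
    intro i hi
    refine ind_neg fun h => ?_
    have h1 := P.ep_vertexStep t ht ω h.1
    have h2 := P.nv_le ht ω
    rw [h.2] at h1
    simp only at h1
    omega
  have h2 : ∀ ω, W ω * (p * P.deg t (u ω) ω / (2 * t)) =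
      ∑ i ∈ Finset.range (t + 1), W ω * ind (u ω = i) *
        (p * (P.deg t i ω : ℝ) / (2 * t)) := fun ω => by
    refine (h0 (W ω) (u ω) (fun i => p * (P.deg t i ω : ℝ) / (2 * t)) ?_).symm
    intro i hi
    simp [P.deg_eq_zero_of_lt ht ω hi]
  simp only [h1, h2]
  rw [integral_finsetSum, integral_finsetSum]
  · exact Finset.sum_congr rfl fun i _ => key i
  · exact fun i _ => ((hw i).mul (((Weight.const _).mul
      (Weight.comp_deg (fun d => (d : ℝ)) measurable_const)).mul
      (Weight.const (2 * t : ℝ)⁻¹))).integrable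
  · exact fun i _ => (((hw i).mono (Nat.le_succ t)).mul (Weight.ind_event (hE i))).integrable

theorem integral_fst_eq {t : ℕ} (ht : 1 ≤ t) {W : P.Ω → ℝ} (hW : P.Weight t W)
    {u : P.Ω → ℕ} (hu : Measurable[P.ℱ t] u) :
    ∫ ω, W ω * ind ((P.ep (t + 1) ω).1 = u ω) ∂P.μ =
      ∫ ω, W ω * (P.deg t (u ω) ω / (2 * t)) ∂P.μ := by
  have h1 : ∀ ω, W ω * ind ((P.ep (t + 1) ω).1 = u ω) =
      W ω * ind (P.Z (t + 1) ω = true ∧ P.ep (t + 1) ω = (u ω, P.nv t ω + 1)) +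
      ∑ j ∈ Finset.range (t + 1),
        W ω * ind (P.Z (t + 1) ω = false ∧ P.ep (t + 1) ω = (u ω, j)) := fun ω => by
    rw [← Finset.mul_sum, ← mul_add]
    congr 1
    have h3 := P.nv_le ht ω
    cases hZ : P.Z (t + 1) ω with
    | true =>
      have h2 := P.ep_vertexStep t ht ω hZ
      simp [ind, Prod.ext_iff, h2.1]
    | false =>
      have h2 := P.ep_edgeStep t ht ω hZ
      have h4 : (P.ep (t + 1) ω).2 < t + 1 := by omega
      by_cases h5 : (P.ep (t + 1) ω).1 = u ω <;> simp [ind, Prod.ext_iff, h5, h4]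
  have h2 : ∀ ω, W ω * (P.deg t (u ω) ω / (2 * t)) =
      W ω * (p * P.deg t (u ω) ω / (2 * t)) + ∑ j ∈ Finset.range (t + 1),
        W ω * ((1 - p) * P.deg t (u ω) ω * P.deg t j ω / (2 * t) ^ 2) := fun ω => by
    rw [← Finset.mul_sum, ← mul_add, ← Finset.sum_div, ← Finset.mul_sum]
    have := P.sum_deg t ω
    have h3 : (∑ i ∈ Finset.range (t + 1), (P.deg t i ω : ℝ)) = 2 * t := by exact_mod_cast this
    rw [h3]
    have : (t : ℝ) ≠ 0 := by positivity
    field_simp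
    ring
  have hd : P.Weight t fun ω => (P.deg t (u ω) ω : ℝ) := Weight.comp_deg (fun d => (d : ℝ)) hu
  have hd' : ∀ j, P.Weight t fun ω => (P.deg t j ω : ℝ) := fun j =>
    Weight.comp_deg (fun d => (d : ℝ)) measurable_const
  have hi : ∀ j, Integrable (fun ω =>
      W ω * ind (P.Z (t + 1) ω = false ∧ P.ep (t + 1) ω = (u ω, j))) P.μ := fun j =>
    ((hW.mono (Nat.le_succ t)).mul
      (Weight.ind_event (P.measurableSet_edgeStep hu measurable_const))).integrable
  have hi' : ∀ j, Integrable (fun ω =>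
      W ω * ((1 - p) * P.deg t (u ω) ω * P.deg t j ω / (2 * t) ^ 2)) P.μ := fun j =>
    (hW.mul ((((Weight.const (1 - p)).mul hd).mul (hd' j)).mul
      (Weight.const ((2 * t : ℝ) ^ 2)⁻¹))).integrable
  simp only [h1, h2]
  rw [integral_add, integral_add, integral_finsetSum _ fun j _ => hi j,
    integral_finsetSum _ fun j _ => hi' j, P.integral_vertexStep ht hW hu]
  · exact congrArg _ (Finset.sum_congr rfl fun j _ =>
      P.integral_edgeStep ht hW hu measurable_const)
  · exact (hW.mul (((Weight.const p).mul hd).mul (Weight.const (2 * t : ℝ)⁻¹))).integrable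
  · exact integrable_finsetSum _ fun j _ => hi' j
  · exact ((hW.mono (Nat.le_succ t)).mul
      (Weight.ind_event (P.measurableSet_vertexStep hu))).integrable
  · exact integrable_finsetSum _ fun j _ => hi j

theorem integral_snd_eq {t : ℕ} (ht : 1 ≤ t) {W : P.Ω → ℝ} (hW : P.Weight t W)
    {u : P.Ω → ℕ} (hu : Measurable[P.ℱ t] u) (hun : ∀ ω, u ω ≤ P.nv t ω) :
    ∫ ω, W ω * ind ((P.ep (t + 1) ω).2 = u ω) ∂P.μ =
      ∫ ω, W ω * ((1 - p) * P.deg t (u ω) ω / (2 * t)) ∂P.μ := by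
  have h1 : ∀ ω, W ω * ind ((P.ep (t + 1) ω).2 = u ω) =
      ∑ j ∈ Finset.range (t + 1),
        W ω * ind (P.Z (t + 1) ω = false ∧ P.ep (t + 1) ω = (j, u ω)) := fun ω => by
    rw [← Finset.mul_sum]
    congr 1
    have h3 := P.nv_le ht ω
    cases hZ : P.Z (t + 1) ω with
    | true =>
      have h2 := P.ep_vertexStep t ht ω hZ
      have h4 := hun ω
      have h5 : ¬(P.ep (t + 1) ω).2 = u ω := by omega
      simp [ind, h5]
    | false =>
      have h2 := P.ep_edgeStep t ht ω hZ
      have h4 : (P.ep (t + 1) ω).1 < t + 1 := by omega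
      by_cases h5 : (P.ep (t + 1) ω).2 = u ω <;> simp [ind, Prod.ext_iff, h5, h4]
  have h2 : ∀ ω, W ω * ((1 - p) * P.deg t (u ω) ω / (2 * t)) =
      ∑ j ∈ Finset.range (t + 1),
        W ω * ((1 - p) * P.deg t j ω * P.deg t (u ω) ω / (2 * t) ^ 2) := fun ω => by
    rw [← Finset.mul_sum, ← Finset.sum_div, ← Finset.sum_mul, ← Finset.mul_sum]
    have := P.sum_deg t ω
    have h3 : (∑ i ∈ Finset.range (t + 1), (P.deg t i ω : ℝ)) = 2 * t := by exact_mod_cast this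
    rw [h3]
    have : (t : ℝ) ≠ 0 := by positivity
    field_simp
  have hd : P.Weight t fun ω => (P.deg t (u ω) ω : ℝ) := Weight.comp_deg (fun d => (d : ℝ)) hu
  have hd' : ∀ j, P.Weight t fun ω => (P.deg t j ω : ℝ) := fun j =>
    Weight.comp_deg (fun d => (d : ℝ)) measurable_const
  simp only [h1, h2]
  rw [integral_finsetSum, integral_finsetSum]
  · exact Finset.sum_congr rfl fun j _ => P.integral_edgeStep ht hW measurable_const hu
  · exact fun j _ => (hW.mul ((((Weight.const (1 - p)).mul (hd' j)).mul hd).mul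
      (Weight.const ((2 * t : ℝ) ^ 2)⁻¹))).integrable
  · exact fun j _ => ((hW.mono (Nat.le_succ t)).mul
      (Weight.ind_event (P.measurableSet_edgeStep measurable_const hu))).integrable

theorem integral_loop_eq {t : ℕ} (ht : 1 ≤ t) {W : P.Ω → ℝ} (hW : P.Weight t W)
    {u : P.Ω → ℕ} (hu : Measurable[P.ℱ t] u) (hun : ∀ ω, u ω ≤ P.nv t ω) :
    ∫ ω, W ω * ind (P.ep (t + 1) ω = (u ω, u ω)) ∂P.μ =
      ∫ ω, W ω * ((1 - p) * P.deg t (u ω) ω * P.deg t (u ω) ω / (2 * t) ^ 2) ∂P.μ := by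
  rw [← P.integral_edgeStep ht hW hu hu]
  refine integral_congr_ae (Eventually.of_forall fun ω => ?_)
  dsimp only
  congr 2
  refine propext ⟨fun h => ⟨?_, h⟩, And.right⟩
  by_contra hZ
  rw [Bool.not_eq_false] at hZ
  have h2 := P.ep_vertexStep t ht ω hZ
  have h4 := hun ω
  rw [h] at h2
  simp only at h2
  omega

/-- One step of the evolution of `f(d_t(u))` for `f` growing at most like a power `d ^ κ`. -/
theorem integral_comp_deg_succ_le (hp0 : 0 < p) (hp1 : p < 1) {t : ℕ} (ht : 1 ≤ t)
    {f : ℕ → ℝ} {κ K : ℝ} (hf0 : ∀ d, 0 ≤ f d) (hK : 0 ≤ K)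
    (hf1 : ∀ d : ℕ, d * (f (d + 1) - f d) ≤ κ * f d)
    (hf2 : ∀ d : ℕ, (d : ℝ) ^ 2 * (f (d + 2) - 2 * f (d + 1) + f d) ≤ K * f d)
    {W : P.Ω → ℝ} (hW : P.Weight t W) (hW0 : ∀ ω, 0 ≤ W ω)
    {u : P.Ω → ℕ} (hu : Measurable[P.ℱ t] u) (hun : ∀ ω, u ω ≤ P.nv t ω) :
    ∫ ω, W ω * f (P.deg (t + 1) (u ω) ω) ∂P.μ ≤
      Real.exp (κ * (1 - p / 2) * (1 / t) + K * (1 / (t : ℝ) ^ 2)) *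
        ∫ ω, W ω * f (P.deg t (u ω) ω) ∂P.μ := by
  set D : P.Ω → ℕ := fun ω => P.deg t (u ω) ω with hD
  have hu' := hu.mono (P.ℱ.mono (Nat.le_succ t)) le_rfl
  have hW' := hW.mono (Nat.le_succ t)
  have hf : ∀ g : ℕ → ℝ, P.Weight t fun ω => g (D ω) := fun g => Weight.comp_deg g hu
  have hw0 := hW.mul (hf f)
  have hw1 := hW.mul (hf fun d => f (d + 1) - f d)
  have hw2 := hW.mul (hf fun d => f (d + 2) - 2 * f (d + 1) + f d)
  have hq1 := hw1.mul (hf fun d => d / (2 * t))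
  have hq2 := hw1.mul (hf fun d => (1 - p) * d / (2 * t))
  have hq3 := hw2.mul (hf fun d => (1 - p) * d * d / (2 * t) ^ 2)
  have hE1 : P.Weight (t + 1) fun ω => ind ((P.ep (t + 1) ω).1 = u ω) :=
    Weight.ind_event (measurableSet_eq_fun (measurable_fst.comp (P.ep_meas _)) hu')
  have hE2 : P.Weight (t + 1) fun ω => ind ((P.ep (t + 1) ω).2 = u ω) :=
    Weight.ind_event (measurableSet_eq_fun (measurable_snd.comp (P.ep_meas _)) hu')
  have hE3 : P.Weight (t + 1) fun ω => ind (P.ep (t + 1) ω = (u ω, u ω)) :=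
    Weight.ind_event (P.measurableSet_ep_eq hu' hu')
  have hi1 := (hw1.mono (Nat.le_succ t)).mul hE1
  have hi2 := (hw1.mono (Nat.le_succ t)).mul hE2
  have hi3 := (hw2.mono (Nat.le_succ t)).mul hE3
  have h1 : ∀ ω, W ω * f (P.deg (t + 1) (u ω) ω) =
      W ω * f (D ω) + W ω * (f (D ω + 1) - f (D ω)) * ind ((P.ep (t + 1) ω).1 = u ω) +
      W ω * (f (D ω + 1) - f (D ω)) * ind ((P.ep (t + 1) ω).2 = u ω) +
      W ω * (f (D ω + 2) - 2 * f (D ω + 1) + f (D ω)) *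
        ind (P.ep (t + 1) ω = (u ω, u ω)) := fun ω => by
    rw [P.deg_succ]
    by_cases ha : (P.ep (t + 1) ω).1 = u ω <;> by_cases hb : (P.ep (t + 1) ω).2 = u ω <;>
      simp [ind, Prod.ext_iff, ha, hb, hD] <;> ring
  calc ∫ ω, W ω * f (P.deg (t + 1) (u ω) ω) ∂P.μ
      = ∫ ω, (W ω * f (D ω) + W ω * (f (D ω + 1) - f (D ω)) * (D ω / (2 * t)) +
          W ω * (f (D ω + 1) - f (D ω)) * ((1 - p) * D ω / (2 * t)) +
          W ω * (f (D ω + 2) - 2 * f (D ω + 1) + f (D ω)) *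
            ((1 - p) * D ω * D ω / (2 * t) ^ 2)) ∂P.μ := by
        simp only [h1]
        rw [integral_add ((hw0.mono (Nat.le_succ t)).add hi1 |>.add hi2).integrable hi3.integrable,
          integral_add ((hw0.mono (Nat.le_succ t)).add hi1).integrable hi2.integrable,
          integral_add hw0.integrable hi1.integrable,
          integral_add ((hw0.add hq1).add hq2).integrable hq3.integrable,
          integral_add (hw0.add hq1).integrable hq2.integrable,
          integral_add hw0.integrable hq1.integrable,
          P.integral_fst_eq ht hw1 hu, P.integral_snd_eq ht hw1 hu hun,
          P.integral_loop_eq ht hw2 hu hun]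
    _ ≤ ∫ ω, Real.exp (κ * (1 - p / 2) * (1 / t) + K * (1 / (t : ℝ) ^ 2)) *
          (W ω * f (D ω)) ∂P.μ := by
        refine integral_mono (((hw0.add hq1).add hq2).add hq3).integrable
          ((Weight.const _).mul hw0).integrable fun ω => ?_
        dsimp only
        have ht0 : (0 : ℝ) < t := by positivity
        have e1 := hf1 (D ω)
        have e2 := hf2 (D ω)
        have e3 : 1 + (κ * (1 - p / 2) * (1 / t) + K * (1 / (t : ℝ) ^ 2)) ≤
            Real.exp (κ * (1 - p / 2) * (1 / t) + K * (1 / (t : ℝ) ^ 2)) := by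
          rw [add_comm]; exact Real.add_one_le_exp _
        have e4 : f (D ω) + (f (D ω + 1) - f (D ω)) * (D ω / (2 * t)) +
            (f (D ω + 1) - f (D ω)) * ((1 - p) * D ω / (2 * t)) +
            (f (D ω + 2) - 2 * f (D ω + 1) + f (D ω)) * ((1 - p) * D ω * D ω / (2 * t) ^ 2) =
            f (D ω) + (1 - p / 2) / t * (D ω * (f (D ω + 1) - f (D ω))) +
            (1 - p) / (4 * t ^ 2) *
              ((D ω : ℝ) ^ 2 * (f (D ω + 2) - 2 * f (D ω + 1) + f (D ω))) := by
          field_simp; ring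
        have e5 : (1 - p / 2) / t * (D ω * (f (D ω + 1) - f (D ω))) ≤
            (1 - p / 2) / t * (κ * f (D ω)) :=
          mul_le_mul_of_nonneg_left e1 (div_nonneg (by linarith) ht0.le)
        have e6 : (1 - p) / (4 * t ^ 2) *
              ((D ω : ℝ) ^ 2 * (f (D ω + 2) - 2 * f (D ω + 1) + f (D ω))) ≤
            (1 - p) / (4 * t ^ 2) * (K * f (D ω)) :=
          mul_le_mul_of_nonneg_left e2 (div_nonneg (by linarith) (by positivity))
        have e7 : (1 - p) / (4 * t ^ 2) * (K * f (D ω)) ≤ 1 / t ^ 2 * (K * f (D ω)) := by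
          refine mul_le_mul_of_nonneg_right ?_ (mul_nonneg hK (hf0 _))
          rw [div_le_div_iff₀ (by positivity) (by positivity)]
          nlinarith [sq_nonneg (t : ℝ)]
        have e8 := mul_le_mul_of_nonneg_right e3 (hf0 (D ω))
        calc _ = W ω * (f (D ω) + (f (D ω + 1) - f (D ω)) * (D ω / (2 * t)) +
            (f (D ω + 1) - f (D ω)) * ((1 - p) * D ω / (2 * t)) +
            (f (D ω + 2) - 2 * f (D ω + 1) + f (D ω)) *
              ((1 - p) * D ω * D ω / (2 * t) ^ 2)) := by ring
          _ ≤ W ω * (Real.exp (κ * (1 - p / 2) * (1 / t) + K * (1 / (t : ℝ) ^ 2)) *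
              f (D ω)) := by
            refine mul_le_mul_of_nonneg_left ?_ (hW0 ω)
            rw [e4]
            refine le_trans ?_ e8
            calc _ ≤ f (D ω) + (1 - p / 2) / t * (κ * f (D ω)) + 1 / t ^ 2 * (K * f (D ω)) := by
                  linarith
              _ = _ := by ring
          _ = _ := by ring
    _ = _ := integral_const_mul _ _

/-- Iteration of `integral_comp_deg_succ_le` from time `s` to time `t`. -/
theorem integral_comp_deg_le (hp0 : 0 < p) (hp1 : p < 1) {s t : ℕ} (hs : 1 ≤ s) (hst : s ≤ t)
    {f : ℕ → ℝ} {κ K : ℝ} (hf0 : ∀ d, 0 ≤ f d) (hK : 0 ≤ K)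
    (hf1 : ∀ d : ℕ, d * (f (d + 1) - f d) ≤ κ * f d)
    (hf2 : ∀ d : ℕ, (d : ℝ) ^ 2 * (f (d + 2) - 2 * f (d + 1) + f d) ≤ K * f d)
    {W : P.Ω → ℝ} (hW : P.Weight s W) (hW0 : ∀ ω, 0 ≤ W ω)
    {u : P.Ω → ℕ} (hu : Measurable[P.ℱ s] u) (hun : ∀ ω, u ω ≤ P.nv s ω) :
    ∫ ω, W ω * f (P.deg t (u ω) ω) ∂P.μ ≤
      Real.exp (κ * (1 - p / 2) * (∑ r ∈ Finset.Ico s t, 1 / (r : ℝ)) +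
        K * ∑ r ∈ Finset.Ico s t, 1 / (r : ℝ) ^ 2) *
        ∫ ω, W ω * f (P.deg s (u ω) ω) ∂P.μ := by
  induction t, hst using Nat.le_induction with
  | base => simp
  | succ t hst ih =>
    refine (P.integral_comp_deg_succ_le hp0 hp1 (hs.trans hst) hf0 hK hf1 hf2 (hW.mono hst) hW0
      (hu.mono (P.ℱ.mono hst) le_rfl) fun ω => (hun ω).trans (P.nv_mono hs hst ω)).trans ?_
    refine (mul_le_mul_of_nonneg_left ih (Real.exp_nonneg _)).trans_eq ?_
    rw [← mul_assoc, ← Real.exp_add, Finset.sum_Ico_succ_top hst, Finset.sum_Ico_succ_top hst]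
    congr 2
    ring

theorem sum_Ico_one_div_le {a t : ℕ} (ha : 1 ≤ a) (hat : a ≤ t) :
    ∑ r ∈ Finset.Ico a t, 1 / (r : ℝ) ≤ 1 + Real.log (t / a) := by
  have ha' : (1 : ℝ) ≤ a := by exact_mod_cast ha
  have key : ∑ r ∈ Finset.Ico a t, 1 / (r : ℝ) ≤ 1 / a - 1 / t + Real.log (t / a) := by
    induction t, hat using Nat.le_induction with
    | base => simp [div_self (show (a : ℝ) ≠ 0 by positivity)]
    | succ t hat ih =>
      have ht : (0 : ℝ) < t := by exact_mod_cast (by omega : 0 < t)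
      rw [Finset.sum_Ico_succ_top hat]
      have h1 := Real.one_sub_inv_le_log_of_pos (show (0 : ℝ) < ((t + 1 : ℕ) : ℝ) / t by positivity)
      rw [Real.log_div (by positivity) (by positivity)] at h1 ih ⊢
      have h2 : 1 - (((t + 1 : ℕ) : ℝ) / t)⁻¹ = 1 / ((t + 1 : ℕ) : ℝ) := by
        push_cast; field_simp; ring
      linarith
  have h1 : 1 / (a : ℝ) ≤ 1 := by rw [div_le_one (by linarith)]; exact ha'
  have h2 : (0 : ℝ) ≤ 1 / t := by positivity
  linarith

theorem log_le_sum_Ico_one_div {a t : ℕ} (ha : 1 ≤ a) (hat : a ≤ t) :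
    Real.log (t / a) ≤ ∑ r ∈ Finset.Ico a t, 1 / (r : ℝ) := by
  have ha' : (1 : ℝ) ≤ a := by exact_mod_cast ha
  induction t, hat using Nat.le_induction with
  | base => simp [div_self (show (a : ℝ) ≠ 0 by positivity)]
  | succ t hat ih =>
    have ht : (0 : ℝ) < t := by exact_mod_cast (by omega : 0 < t)
    rw [Finset.sum_Ico_succ_top hat]
    have h1 := Real.log_le_sub_one_of_pos (show (0 : ℝ) < ((t + 1 : ℕ) : ℝ) / t by positivity)
    rw [Real.log_div (by positivity) (by positivity)] at h1 ih ⊢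
    have h2 : ((t + 1 : ℕ) : ℝ) / t - 1 = 1 / (t : ℝ) := by
      push_cast; field_simp; ring
    linarith

theorem sum_Ico_one_div_sq_le {a t : ℕ} (ha : 1 ≤ a) (hat : a ≤ t) :
    ∑ r ∈ Finset.Ico a t, 1 / (r : ℝ) ^ 2 ≤ 2 := by
  have ha' : (1 : ℝ) ≤ a := by exact_mod_cast ha
  have key : ∑ r ∈ Finset.Ico a t, 1 / (r : ℝ) ^ 2 ≤ 2 / (a : ℝ) - 2 / (t : ℝ) := by
    induction t, hat using Nat.le_induction with
    | base => simp
    | succ t hat ih =>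
      have ht : (1 : ℝ) ≤ t := by exact_mod_cast (by omega : 1 ≤ t)
      rw [Finset.sum_Ico_succ_top hat]
      have h2 : 1 / (t : ℝ) ^ 2 ≤ 2 / (t : ℝ) - 2 / ((t + 1 : ℕ) : ℝ) := by
        push_cast
        rw [div_sub_div _ _ (by positivity) (by positivity),
          div_le_div_iff₀ (by positivity) (by positivity)]
        nlinarith
      linarith
  have h1 : 2 / (a : ℝ) ≤ 2 := by rw [div_le_iff₀ (by linarith)]; linarith
  have h2 : (0 : ℝ) ≤ 2 / t := by positivity
  linarith

/-- Moment growth: if `d * f (d + 1) = (d + κ) * f d`, then `f(d_t(u))` grows in mean at most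
like `t ^ (κ (1 - p / 2))`. -/
theorem integral_comp_deg_le_rpow (hp0 : 0 < p) (hp1 : p < 1) {s t : ℕ} (hs : 1 ≤ s)
    (hst : s ≤ t) {f : ℕ → ℝ} {κ : ℝ} (hf0 : ∀ d, 0 ≤ f d)
    (hf : ∀ d : ℕ, d * f (d + 1) = (d + κ) * f d)
    {W : P.Ω → ℝ} (hW : P.Weight s W) (hW0 : ∀ ω, 0 ≤ W ω)
    {u : P.Ω → ℕ} (hu : Measurable[P.ℱ s] u) (hun : ∀ ω, u ω ≤ P.nv s ω) :
    ∫ ω, W ω * f (P.deg t (u ω) ω) ∂P.μ ≤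
      Real.exp (|κ| + 2 * |κ ^ 2 - κ|) * ((t : ℝ) / s) ^ (κ * (1 - p / 2)) *
        ∫ ω, W ω * f (P.deg s (u ω) ω) ∂P.μ := by
  have hs' : (0 : ℝ) < s := by exact_mod_cast hs
  have ht' : (0 : ℝ) < t := by exact_mod_cast hs.trans hst
  refine (P.integral_comp_deg_le (κ := κ) hp0 hp1 hs hst hf0 (abs_nonneg (κ ^ 2 - κ))
    (fun d => by rw [mul_sub, hf]; linarith) (fun d => ?_) hW hW0 hu hun).trans ?_
  · have h1 := hf d
    have h2 := hf (d + 1)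
    push_cast at h2
    have h3 : (d : ℝ) * (d + 1) * (f (d + 2) - 2 * f (d + 1) + f d) = (κ ^ 2 - κ) * f d := by
      linear_combination d * h2 + (κ - d - 1) * h1
    have hd : (0 : ℝ) ≤ d := d.cast_nonneg
    have h4 := mul_le_mul_of_nonneg_right (le_abs_self (κ ^ 2 - κ)) (hf0 d)
    have h5 : (d : ℝ) ^ 2 * (f (d + 2) - 2 * f (d + 1) + f d) =
        d / (d + 1) * ((κ ^ 2 - κ) * f d) := by
      rw [← h3]; field_simp
    rw [h5]
    have h6 : (d : ℝ) / (d + 1) ≤ 1 := by rw [div_le_one (by linarith)]; linarith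
    have h7 : (0 : ℝ) ≤ d / (d + 1) := by positivity
    calc _ ≤ (d : ℝ) / (d + 1) * (|κ ^ 2 - κ| * f d) := mul_le_mul_of_nonneg_left h4 h7
      _ ≤ 1 * (|κ ^ 2 - κ| * f d) :=
        mul_le_mul_of_nonneg_right h6 (mul_nonneg (abs_nonneg _) (hf0 d))
      _ = _ := one_mul _
  · refine mul_le_mul_of_nonneg_right ?_
      (integral_nonneg fun ω => mul_nonneg (hW0 ω) (hf0 _))
    rw [Real.rpow_def_of_pos (by positivity), ← Real.exp_add, Real.exp_le_exp]
    have h1 := sum_Ico_one_div_le hs hst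
    have h2 := log_le_sum_Ico_one_div hs hst
    have h3 := mul_le_mul_of_nonneg_left (sum_Ico_one_div_sq_le hs hst)
      (abs_nonneg (κ ^ 2 - κ))
    set S := ∑ r ∈ Finset.Ico s t, 1 / (r : ℝ)
    have h4 : κ * (1 - p / 2) * (S - Real.log (t / s)) ≤ |κ| * 1 := by
      rw [mul_assoc]
      refine (le_abs_self _).trans ?_
      rw [abs_mul]
      refine mul_le_mul_of_nonneg_left ?_ (abs_nonneg κ)
      rw [abs_of_nonneg (mul_nonneg (by linarith) (by linarith))]
      nlinarith
    nlinarith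

/-- The vertex added at time `a`, or `0` if no vertex is added at time `a`. -/
noncomputable def bornAt (a : ℕ) (ω : P.Ω) : ℕ := if a = 1 ∨ P.Z a ω = true then P.nv a ω else 0

theorem bornAt_le (a : ℕ) (ω : P.Ω) : P.bornAt a ω ≤ P.nv a ω := by
  unfold bornAt; split_ifs <;> omega

theorem measurable_bornAt (a : ℕ) : Measurable[P.ℱ a] (P.bornAt a) := by
  unfold bornAt
  refine Measurable.ite ?_ (P.nv_meas a) measurable_const
  exact (MeasurableSet.const _).union (P.measurableSet_Z a true)

theorem bornAt_eq_succ {a : ℕ} (ha : 1 ≤ a) {ω : P.Ω} (h : P.bornAt (a + 1) ω ≠ 0) :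
    P.bornAt (a + 1) ω = P.nv a ω + 1 ∧ P.nv (a + 1) ω = P.nv a ω + 1 ∧
      P.Z (a + 1) ω = true := by
  have hn := P.nv_succ a ha ω
  unfold bornAt at h ⊢
  split_ifs at h ⊢ with h1
  · rcases h1 with h1 | h1
    · omega
    · simp only [h1, if_true] at hn
      exact ⟨hn, hn, h1⟩
  · exact absurd rfl h

theorem bornAt_lt {a b : ℕ} (ha : 1 ≤ a) (hab : a < b) {ω : P.Ω} (hb : P.bornAt b ω ≠ 0) :
    P.nv a ω < P.bornAt b ω := by
  obtain ⟨b, rfl⟩ : ∃ c, b = c + 1 := ⟨b - 1, by omega⟩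
  rw [(P.bornAt_eq_succ (by omega) hb).1]
  have := P.nv_mono ha (Nat.lt_succ_iff.1 hab) ω
  omega

theorem deg_bornAt_le_two {a : ℕ} (ha : 1 ≤ a) (ω : P.Ω) : P.deg a (P.bornAt a ω) ω ≤ 2 := by
  obtain rfl | ⟨s, rfl, hs⟩ : a = 1 ∨ ∃ s, a = s + 1 ∧ 1 ≤ s := by
    rcases Nat.lt_or_ge 1 a with h | h
    · exact .inr ⟨a - 1, by omega, by omega⟩
    · exact .inl (by omega)
  · rw [P.deg_one]; split_ifs <;> omega
  · by_cases h : P.bornAt (s + 1) ω = 0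
    · rw [P.deg_eq_zero ω (.inl h)]; omega
    · have h1 := P.bornAt_eq_succ hs h
      rw [P.deg_succ, P.deg_eq_zero ω (.inr (by omega))]
      split_ifs <;> omega

theorem exists_bornAt_eq {t : ℕ} (ht : 1 ≤ t) (ω : P.Ω) {i : ℕ} (hi : 1 ≤ i)
    (hit : i ≤ P.nv t ω) : ∃ a ∈ Finset.Icc 1 t, P.bornAt a ω = i := by
  induction t, ht using Nat.le_induction with
  | base =>
    rw [P.nv_one] at hit
    exact ⟨1, by simp, by simp [bornAt, P.nv_one]; omega⟩
  | succ t ht ih =>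
    by_cases h : i ≤ P.nv t ω
    · obtain ⟨a, ha, h1⟩ := ih h
      rw [Finset.mem_Icc] at ha
      exact ⟨a, Finset.mem_Icc.2 ⟨ha.1, by omega⟩, h1⟩
    · have hn := P.nv_succ t ht ω
      cases hZ : P.Z (t + 1) ω with
      | true =>
        simp only [hZ, if_true] at hn
        refine ⟨t + 1, by simp, ?_⟩
        simp only [bornAt, hZ, or_true, if_true]
        omega
      | false => simp [hZ] at hn; omega

theorem exists_integral_deg_pow_le (hp0 : 0 < p) (hp1 : p < 1) (k : ℕ) :
    ∃ C : ℝ, 0 ≤ C ∧ ∀ a t : ℕ, 1 ≤ a → a ≤ t →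
      ∫ ω, (P.deg t (P.bornAt a ω) ω : ℝ) ^ k ∂P.μ ≤
        C * (((t : ℝ) / a) ^ (1 - p / 2)) ^ k := by
  set f : ℕ → ℝ := fun d => d.ascFactorial k with hf
  have hf0 : ∀ d, 0 ≤ f d := fun d => Nat.cast_nonneg _
  have hf1 : ∀ d : ℕ, d * f (d + 1) = (d + k) * f d := fun d => by
    simp only [hf]; exact_mod_cast Nat.succ_ascFactorial d k
  refine ⟨Real.exp (|(k : ℝ)| + 2 * |(k : ℝ) ^ 2 - k|) * (f 0 + f 1 + f 2),
    mul_nonneg (Real.exp_nonneg _) (by have := hf0 0; have := hf0 1; have := hf0 2; linarith),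
    fun a t ha hat => ?_⟩
  have hu := P.measurable_bornAt a
  have h := P.integral_comp_deg_le_rpow hp0 hp1 ha hat hf0 hf1 (Weight.const 1)
    (fun _ => zero_le_one) hu (P.bornAt_le a)
  simp only [one_mul] at h
  have h1 : ∫ ω, f (P.deg a (P.bornAt a ω) ω) ∂P.μ ≤ f 0 + f 1 + f 2 := by
    have : ∫ ω, f (P.deg a (P.bornAt a ω) ω) ∂P.μ ≤ ∫ _, (f 0 + f 1 + f 2) ∂P.μ := by
      refine integral_mono (Weight.comp_deg f hu).integrable (integrable_const _) fun ω => ?_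
      have h2 := P.deg_bornAt_le_two ha ω
      have := hf0 0; have := hf0 1; have := hf0 2
      dsimp only
      interval_cases P.deg a (P.bornAt a ω) ω <;> linarith
    simpa using this
  have hu' := hu.mono (P.ℱ.mono hat) le_rfl
  calc ∫ ω, (P.deg t (P.bornAt a ω) ω : ℝ) ^ k ∂P.μ
      ≤ ∫ ω, f (P.deg t (P.bornAt a ω) ω) ∂P.μ := by
        refine integral_mono (Weight.comp_deg (fun d => (d : ℝ) ^ k) hu').integrable
          (Weight.comp_deg f hu').integrable fun ω => ?_
        simp only [hf]
        exact_mod_cast Nat.pow_succ_le_ascFactorial (P.deg t (P.bornAt a ω) ω) k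
    _ ≤ _ := h
    _ ≤ Real.exp (|(k : ℝ)| + 2 * |(k : ℝ) ^ 2 - k|) *
          ((t : ℝ) / a) ^ ((k : ℝ) * (1 - p / 2)) * (f 0 + f 1 + f 2) := by
        refine mul_le_mul_of_nonneg_left h1 ?_
        positivity
    _ = _ := by
        rw [mul_comm (k : ℝ), Real.rpow_mul (by positivity), Real.rpow_natCast]
        ring

/-- All degrees up to time `s` are at most `B` times their typical size. -/
def DegBound (B : ℝ) (s : ℕ) (ω : P.Ω) : Prop :=
  ∀ r ∈ Finset.Icc 1 s, ∀ a ∈ Finset.Icc 1 r,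
    (P.deg r (P.bornAt a ω) ω : ℝ) ≤ ((r : ℝ) / a) ^ (1 - p / 2) * B

theorem DegBound.mono {B : ℝ} {s t : ℕ} (hst : s ≤ t) {ω : P.Ω} (h : P.DegBound B t ω) :
    P.DegBound B s ω := fun r hr => h r (Finset.Icc_subset_Icc_right hst hr)

theorem measurableSet_degBound (B : ℝ) (s : ℕ) :
    MeasurableSet[P.ℱ s] {ω | P.DegBound B s ω} := by
  simp only [DegBound, Set.ofPred_forall]
  refine Finset.measurableSet_biInter _ fun r hr => Finset.measurableSet_biInter _ fun a ha => ?_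
  rw [Finset.mem_Icc] at hr ha
  refine P.ℱ.mono hr.2 _ ?_
  exact measurableSet_le ((measurable_from_nat (f := fun d : ℕ => (d : ℝ))).comp
    (P.measurable_deg ((P.measurable_bornAt a).mono (P.ℱ.mono ha.2) le_rfl))) measurable_const

theorem exists_measure_not_degBound_le (hp0 : 0 < p) (hp1 : p < 1) (k : ℕ) :
    ∃ C : ℝ, 0 ≤ C ∧ ∀ (t : ℕ) (B : ℝ), 0 < B →
      P.μ.real {ω | ¬P.DegBound B t ω} ≤ (t : ℝ) ^ 2 * (C / B ^ k) := by
  obtain ⟨C, hC, h⟩ := P.exists_integral_deg_pow_le hp0 hp1 k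
  refine ⟨C, hC, fun t B hB => ?_⟩
  have hsub : {ω | ¬P.DegBound B t ω} ⊆ ⋃ x ∈ Finset.Icc 1 t ×ˢ Finset.Icc 1 t,
      {ω | x.2 ≤ x.1 ∧ ((x.1 : ℝ) / x.2) ^ (1 - p / 2) * B ≤
        (P.deg x.1 (P.bornAt x.2 ω) ω : ℝ)} := by
    intro ω hω
    simp only [DegBound, Set.mem_ofPred_eq, not_forall, not_le] at hω
    obtain ⟨r, hr, a, ha, hω⟩ := hω
    rw [Finset.mem_Icc] at hr ha
    simp only [Set.mem_iUnion]
    exact ⟨(r, a), by simp; omega, ha.2, hω.le⟩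
  refine (measureReal_mono hsub (measure_ne_top _ _)).trans
    ((measureReal_biUnion_finset_le _ _).trans ?_)
  have hb : ∀ x ∈ Finset.Icc 1 t ×ˢ Finset.Icc 1 t,
      P.μ.real {ω | x.2 ≤ x.1 ∧ ((x.1 : ℝ) / x.2) ^ (1 - p / 2) * B ≤
        (P.deg x.1 (P.bornAt x.2 ω) ω : ℝ)} ≤ C / B ^ k := by
    rintro ⟨r, a⟩ hx
    simp only [Finset.mem_product, Finset.mem_Icc] at hx
    dsimp only
    by_cases har : a ≤ r
    · have hq : 0 < ((r : ℝ) / a) ^ (1 - p / 2) := by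
        have : (0 : ℝ) < a := by exact_mod_cast hx.2.1
        have : (0 : ℝ) < r := by exact_mod_cast hx.1.1
        positivity
      set q := ((r : ℝ) / a) ^ (1 - p / 2)
      have hm := mul_meas_ge_le_integral_of_nonneg (μ := P.μ)
        (f := fun ω => (P.deg r (P.bornAt a ω) ω : ℝ) ^ k)
        (Eventually.of_forall fun ω => by positivity)
        (Weight.comp_deg (fun d => (d : ℝ) ^ k)
          ((P.measurable_bornAt a).mono (P.ℱ.mono har) le_rfl)).integrable ((q * B) ^ k)
      have h1 := hm.trans (h a r hx.2.1 har)
      have h2 : P.μ.real {ω | a ≤ r ∧ q * B ≤ (P.deg r (P.bornAt a ω) ω : ℝ)} ≤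
          P.μ.real {ω | (q * B) ^ k ≤ (P.deg r (P.bornAt a ω) ω : ℝ) ^ k} :=
        measureReal_mono (fun ω hω => pow_le_pow_left₀ (by positivity) hω.2 k)
          (measure_ne_top _ _)
      refine h2.trans ?_
      rw [le_div_iff₀ (by positivity)]
      set m := P.μ.real {ω | (q * B) ^ k ≤ (P.deg r (P.bornAt a ω) ω : ℝ) ^ k}
      rw [mul_pow] at h1
      refine le_of_mul_le_mul_left ?_ (pow_pos hq k)
      linarith
    · simp [har]
      positivity
  refine (Finset.sum_le_sum hb).trans_eq ?_
  rw [Finset.sum_const, Finset.card_product, Nat.card_Icc, nsmul_eq_mul]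
  push_cast
  ring

/-- At step `t`, an edge is added between the vertices born at times `x.1` and `x.2`. -/
def NewEdge (x : ℕ × ℕ) (t : ℕ) (ω : P.Ω) : Prop :=
  x.2 ≤ t ∧ (P.ep t ω = (P.bornAt x.1 ω, P.bornAt x.2 ω) ∨
    P.ep t ω = (P.bornAt x.2 ω, P.bornAt x.1 ω))

/-- By time `t`, an edge joins the vertices born at times `x.1` and `x.2`. -/
def BornJoined (x : ℕ × ℕ) (t : ℕ) (ω : P.Ω) : Prop := ∃ s ∈ Finset.Icc 1 t, P.NewEdge x s ω

/-- An upper bound for the conditional probability that step `t + 1` joins the vertices born at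
times `x.1 < x.2`, when all degrees are at most `B` times their typical size. -/
noncomputable def joinRate (p B : ℝ) (x : ℕ × ℕ) (t : ℕ) : ℝ :=
  if x.2 ≤ t then
    (((t : ℝ) / x.1) ^ (1 - p / 2) * B) * (((t : ℝ) / x.2) ^ (1 - p / 2) * B) / (2 * (t : ℝ) ^ 2)
  else if x.2 = t + 1 then ((t : ℝ) / x.1) ^ (1 - p / 2) * B / (2 * t) else 0

theorem joinRate_nonneg {B : ℝ} (hB : 0 ≤ B) (x : ℕ × ℕ) (t : ℕ) : 0 ≤ joinRate p B x t := by
  unfold joinRate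
  split_ifs <;> positivity

theorem measurableSet_newEdge {x : ℕ × ℕ} (hx : x.1 < x.2) (t : ℕ) :
    MeasurableSet[P.ℱ t] {ω | P.NewEdge x t ω} := by
  by_cases h : x.2 ≤ t
  · have h1 := (P.measurable_bornAt x.1).mono (P.ℱ.mono (hx.le.trans h)) le_rfl
    have h2 := (P.measurable_bornAt x.2).mono (P.ℱ.mono h) le_rfl
    exact (MeasurableSet.const _).inter
      ((P.measurableSet_ep_eq h1 h2).union (P.measurableSet_ep_eq h2 h1))
  · simp [NewEdge, h]

theorem measurableSet_bornJoined {x : ℕ × ℕ} (hx : x.1 < x.2) (t : ℕ) :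
    MeasurableSet[P.ℱ t] {ω | P.BornJoined x t ω} := by
  have h : {ω | P.BornJoined x t ω} = ⋃ s ∈ Finset.Icc 1 t, {ω | P.NewEdge x s ω} := by
    ext ω; simp [BornJoined]
  rw [h]
  exact Finset.measurableSet_biUnion _ fun s hs =>
    P.ℱ.mono (Finset.mem_Icc.1 hs).2 _ (P.measurableSet_newEdge hx s)

theorem bornJoined_succ (x : ℕ × ℕ) (t : ℕ) (ω : P.Ω) :
    P.BornJoined x (t + 1) ω ↔ P.BornJoined x t ω ∨ P.NewEdge x (t + 1) ω := by
  constructor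
  · rintro ⟨s, hs, h⟩
    rw [Finset.mem_Icc] at hs
    rcases Nat.lt_or_ge t s with h1 | h1
    · rw [show t + 1 = s by omega]; exact .inr h
    · exact .inl ⟨s, Finset.mem_Icc.2 ⟨hs.1, h1⟩, h⟩
  · rintro (⟨s, hs, h⟩ | h)
    · rw [Finset.mem_Icc] at hs
      exact ⟨s, Finset.mem_Icc.2 ⟨hs.1, by omega⟩, h⟩
    · exact ⟨t + 1, by simp, h⟩

theorem bornAt_inj {a b : ℕ} (ha : 1 ≤ a) (hb : 1 ≤ b) {ω : P.Ω} (h0 : P.bornAt a ω ≠ 0)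
    (h : P.bornAt a ω = P.bornAt b ω) : a = b := by
  have h1 := P.bornAt_le a ω
  have h2 := P.bornAt_le b ω
  rcases lt_trichotomy a b with hab | hab | hab
  · have := P.bornAt_lt ha hab (h ▸ h0); omega
  · exact hab
  · have := P.bornAt_lt hb hab h0; omega

theorem NewEdge.eq {x y : ℕ × ℕ} (hx1 : 1 ≤ x.1) (hx : x.1 < x.2) (hy1 : 1 ≤ y.1)
    (hy : y.1 < y.2) {t : ℕ} (ht : 1 ≤ t) {ω : P.Ω} (h : P.NewEdge x t ω)
    (h' : P.NewEdge y t ω) : x = y := by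
  have hm := P.ep_mem ht ω
  obtain ⟨-, h⟩ := h
  obtain ⟨-, h'⟩ := h'
  simp only [Prod.ext_iff] at h h' ⊢
  have e1 := fun h0 => P.bornAt_inj (ω := ω) (a := x.1) (b := y.1) hx1 hy1 h0
  have e2 := fun h0 => P.bornAt_inj (ω := ω) (a := x.2) (b := y.2) (by omega) (by omega) h0
  have e3 := fun h0 => P.bornAt_inj (ω := ω) (a := x.1) (b := y.2) hx1 (by omega) h0
  have e4 := fun h0 => P.bornAt_inj (ω := ω) (a := x.2) (b := y.1) (by omega) hy1 h0
  rcases h with h | h <;> rcases h' with h' | h'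
  · exact ⟨e1 (by omega) (by omega), e2 (by omega) (by omega)⟩
  · have := e3 (by omega) (by omega)
    have := e4 (by omega) (by omega)
    omega
  · have := e3 (by omega) (by omega)
    have := e4 (by omega) (by omega)
    omega
  · exact ⟨e1 (by omega) (by omega), e2 (by omega) (by omega)⟩

theorem integral_newEdge_le (hp0 : 0 < p) (hp1 : p < 1) {B : ℝ} {x : ℕ × ℕ}
    (hx1 : 1 ≤ x.1) (hx : x.1 < x.2) {t : ℕ} (ht : 1 ≤ t) {W : P.Ω → ℝ} (hW : P.Weight t W)
    (hW0 : ∀ ω, 0 ≤ W ω) (hWB : ∀ ω, W ω ≠ 0 → P.DegBound B t ω) :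
    ∫ ω, W ω * ind (P.NewEdge x (t + 1) ω) ∂P.μ ≤ joinRate p B x t * ∫ ω, W ω ∂P.μ := by
  have ht' : (0 : ℝ) < t := by exact_mod_cast ht
  have hN := P.measurableSet_newEdge hx (t + 1)
  have hWi := ((hW.mono (Nat.le_succ t)).mul (Weight.ind_event hN)).integrable
  have hdeg : ∀ a ∈ Finset.Icc 1 t, ∀ ω, W ω ≠ 0 →
      (P.deg t (P.bornAt a ω) ω : ℝ) ≤ ((t : ℝ) / a) ^ (1 - p / 2) * B := fun a ha ω hω =>
    hWB ω hω t (by simp; omega) a ha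
  have hmeas : ∀ a ≤ t, Measurable[P.ℱ t] (P.bornAt a) := fun a ha =>
    (P.measurable_bornAt a).mono (P.ℱ.mono ha) le_rfl
  unfold joinRate
  split_ifs with h1 h2
  · have hu := hmeas x.1 (by omega)
    have hv := hmeas x.2 (by omega)
    have e1 := Weight.ind_event (P.measurableSet_edgeStep hu hv)
    have e2 := Weight.ind_event (P.measurableSet_edgeStep hv hu)
    have e1' := ((hW.mono (Nat.le_succ t)).mul e1).integrable
    have e2' := ((hW.mono (Nat.le_succ t)).mul e2).integrable
    set q := (((t : ℝ) / x.1) ^ (1 - p / 2) * B) * (((t : ℝ) / x.2) ^ (1 - p / 2) * B) with hq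
    have key : ∫ ω, W ω * ((1 - p) * P.deg t (P.bornAt x.1 ω) ω *
        P.deg t (P.bornAt x.2 ω) ω / (2 * t) ^ 2) ∂P.μ ≤
        q / (4 * (t : ℝ) ^ 2) * ∫ ω, W ω ∂P.μ := by
      rw [← integral_const_mul]
      refine integral_mono_of_nonneg (Eventually.of_forall fun ω => ?_)
        (hW.integrable.const_mul _) (Eventually.of_forall fun ω => ?_)
      · have : 0 ≤ 1 - p := by linarith
        exact mul_nonneg (hW0 ω) (by positivity)
      · dsimp only
        by_cases hω : W ω = 0
        · simp [hω]
        · rw [mul_comm (q / _)]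
          refine mul_le_mul_of_nonneg_left ?_ (hW0 ω)
          rw [mul_pow]
          norm_num only
          refine div_le_div_of_nonneg_right ?_ (by positivity)
          have d1 := hdeg x.1 (by simp; omega) ω hω
          have d2 := hdeg x.2 (by simp; omega) ω hω
          have d3 := mul_le_mul d1 d2 (by positivity) ((Nat.cast_nonneg _).trans d1)
          rw [mul_assoc]
          refine le_trans ?_ d3
          exact mul_le_of_le_one_left (by positivity) (by linarith)
    calc ∫ ω, W ω * ind (P.NewEdge x (t + 1) ω) ∂P.μ
        ≤ ∫ ω, (W ω * ind (P.Z (t + 1) ω = false ∧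
              P.ep (t + 1) ω = (P.bornAt x.1 ω, P.bornAt x.2 ω)) +
            W ω * ind (P.Z (t + 1) ω = false ∧
              P.ep (t + 1) ω = (P.bornAt x.2 ω, P.bornAt x.1 ω))) ∂P.μ := by
          refine integral_mono hWi (e1'.add e2') fun ω => ?_
          dsimp only
          rw [← mul_add]
          refine mul_le_mul_of_nonneg_left ?_ (hW0 ω)
          by_cases hE : P.NewEdge x (t + 1) ω
          · have hZ : P.Z (t + 1) ω = false := by
              by_contra hZ
              rw [Bool.not_eq_false] at hZ
              have := P.ep_vertexStep t ht ω hZ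
              have b1 := P.bornAt_le x.1 ω
              have b2 := P.bornAt_le x.2 ω
              have b3 := P.nv_mono hx1 (by omega : x.1 ≤ t) ω
              have b4 := P.nv_mono (by omega) h1 ω
              rcases hE.2 with hE | hE <;> simp only [hE] at this <;> omega
            rw [ind_pos hE]
            rcases hE.2 with hE | hE
            · have := ind_nonneg (P.Z (t + 1) ω = false ∧
                P.ep (t + 1) ω = (P.bornAt x.2 ω, P.bornAt x.1 ω))
              rw [ind_pos (A := P.Z (t + 1) ω = false ∧
                P.ep (t + 1) ω = (P.bornAt x.1 ω, P.bornAt x.2 ω)) ⟨hZ, hE⟩]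
              linarith
            · have := ind_nonneg (P.Z (t + 1) ω = false ∧
                P.ep (t + 1) ω = (P.bornAt x.1 ω, P.bornAt x.2 ω))
              rw [ind_pos (A := P.Z (t + 1) ω = false ∧
                P.ep (t + 1) ω = (P.bornAt x.2 ω, P.bornAt x.1 ω)) ⟨hZ, hE⟩]
              linarith
          · rw [ind_neg hE]
            exact add_nonneg (ind_nonneg _) (ind_nonneg _)
      _ ≤ q / (4 * (t : ℝ) ^ 2) * ∫ ω, W ω ∂P.μ + q / (4 * (t : ℝ) ^ 2) * ∫ ω, W ω ∂P.μ := by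
          rw [integral_add e1' e2', P.integral_edgeStep ht hW hu hv,
            P.integral_edgeStep ht hW hv hu]
          refine add_le_add key (le_of_eq_of_le ?_ key)
          congr 1
          ext ω
          ring
      _ = _ := by field_simp; ring
  · have hu := hmeas x.1 (by omega)
    have e1' := ((hW.mono (Nat.le_succ t)).mul
      (Weight.ind_event (P.measurableSet_vertexStep hu))).integrable
    calc ∫ ω, W ω * ind (P.NewEdge x (t + 1) ω) ∂P.μ
        ≤ ∫ ω, W ω * ind (P.Z (t + 1) ω = true ∧
              P.ep (t + 1) ω = (P.bornAt x.1 ω, P.nv t ω + 1)) ∂P.μ := by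
          refine integral_mono hWi e1' fun ω => ?_
          refine mul_le_mul_of_nonneg_left (ind_mono fun hE => ?_) (hW0 ω)
          have hE := hE.2
          rw [h2] at hE
          have hm := P.ep_mem (show 1 ≤ t + 1 by omega) ω
          have hb : P.bornAt (t + 1) ω ≠ 0 := by
            rcases hE with hE | hE <;> simp only [hE] at hm <;> omega
          obtain ⟨g1, g2, g3⟩ := P.bornAt_eq_succ ht hb
          have hv := P.ep_vertexStep t ht ω g3
          rw [g1] at hE
          refine ⟨g3, ?_⟩
          rcases hE with hE | hE
          · exact hE
          · simp only [hE] at hv; omega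
      _ = ∫ ω, W ω * (p * P.deg t (P.bornAt x.1 ω) ω / (2 * t)) ∂P.μ :=
          P.integral_vertexStep ht hW hu
      _ ≤ _ := by
          rw [← integral_const_mul]
          refine integral_mono_of_nonneg (Eventually.of_forall fun ω => ?_)
            (hW.integrable.const_mul _) (Eventually.of_forall fun ω => ?_)
          · exact mul_nonneg (hW0 ω) (by positivity)
          · dsimp only
            by_cases hω : W ω = 0
            · simp [hω]
            · rw [mul_comm _ (W ω)]
              refine mul_le_mul_of_nonneg_left ?_ (hW0 ω)
              refine div_le_div_of_nonneg_right ?_ (by positivity)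
              refine le_trans ?_ (hdeg x.1 (by simp; omega) ω hω)
              exact mul_le_of_le_one_left (by positivity) hp1.le
  · have h : ∀ ω, W ω * ind (P.NewEdge x (t + 1) ω) = 0 := fun ω => by
      rw [ind_neg fun hE => by have := hE.1; omega, mul_zero]
    simp [h]

theorem prod_add_sum_erase_le {ι : Type*} [DecidableEq ι] (I : Finset ι) {Q q : ι → ℝ}
    (hQ : ∀ i, 0 ≤ Q i) (hq : ∀ i, 0 ≤ q i) :
    ∏ i ∈ I, Q i + ∑ j ∈ I, q j * ∏ i ∈ I.erase j, Q i ≤ ∏ i ∈ I, (Q i + q i) := by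
  induction I using Finset.induction_on with
  | empty => simp
  | insert k I hk ih =>
    rw [Finset.prod_insert hk, Finset.prod_insert hk, Finset.sum_insert hk,
      Finset.erase_insert hk]
    have h : ∑ j ∈ I, q j * ∏ i ∈ (insert k I).erase j, Q i =
        Q k * ∑ j ∈ I, q j * ∏ i ∈ I.erase j, Q i := by
      rw [Finset.mul_sum]
      refine Finset.sum_congr rfl fun j hj => ?_
      have hjk : k ≠ j := fun h => hk (h ▸ hj)
      rw [Finset.erase_insert_of_ne hjk,
        Finset.prod_insert fun h => hk (Finset.mem_of_mem_erase h)]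
      ring
    rw [h]
    have h1 : 0 ≤ ∑ j ∈ I, q j * ∏ i ∈ I.erase j, Q i :=
      Finset.sum_nonneg fun j _ => mul_nonneg (hq j) (Finset.prod_nonneg fun i _ => hQ i)
    nlinarith [mul_le_mul_of_nonneg_left ih (add_nonneg (hQ k) (hq k)), mul_nonneg (hq k) h1]

/-- Joint connection probabilities are at most the product of the individual bounds. -/
theorem integral_bornJoined_le (hp0 : 0 < p) (hp1 : p < 1) {B : ℝ} (hB : 0 ≤ B) {t : ℕ}
    (ht : 1 ≤ t) (I : Finset (ℕ × ℕ)) (hI : ∀ x ∈ I, 1 ≤ x.1 ∧ x.1 < x.2) :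
    ∫ ω, ind (P.DegBound B t ω ∧ ∀ x ∈ I, P.BornJoined x t ω) ∂P.μ ≤
      ∏ x ∈ I, ∑ r ∈ Finset.Ico 1 t, joinRate p B x r := by
  have hw : ∀ (t : ℕ) (I : Finset (ℕ × ℕ)), (∀ x ∈ I, 1 ≤ x.1 ∧ x.1 < x.2) →
      P.Weight t fun ω => ind (P.DegBound B t ω ∧ ∀ x ∈ I, P.BornJoined x t ω) := by
    intro t I hI
    have h : MeasurableSet[P.ℱ t] {ω | ∀ x ∈ I, P.BornJoined x t ω} := by
      simp only [Set.ofPred_forall]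
      exact Finset.measurableSet_biInter _ fun x hx => P.measurableSet_bornJoined (hI x hx).2 t
    exact Weight.ind_event ((P.measurableSet_degBound B t).inter h)
  induction t, ht using Nat.le_induction generalizing I with
  | base =>
    rcases I.eq_empty_or_nonempty with rfl | ⟨y, hy⟩
    · calc _ ≤ ∫ _, (1 : ℝ) ∂P.μ :=
            integral_mono (hw 1 ∅ (by simp)).integrable (integrable_const _) fun ω => ind_le_one _
        _ = _ := by simp
    · have h : ∀ ω, ind (P.DegBound B 1 ω ∧ ∀ x ∈ I, P.BornJoined x 1 ω) = 0 := fun ω =>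
        ind_neg fun hω => by
          obtain ⟨s, hs, h, -⟩ := hω.2 y hy
          have := hI y hy
          rw [Finset.mem_Icc] at hs
          omega
      simp only [h, integral_zero]
      exact Finset.prod_nonneg fun x _ => Finset.sum_nonneg fun r _ => joinRate_nonneg hB x r
  | succ t ht ih =>
    have hI' : ∀ j, ∀ x ∈ I.erase j, 1 ≤ x.1 ∧ x.1 < x.2 := fun j x hx =>
      hI x (Finset.mem_of_mem_erase hx)
    have hterm : ∀ j ∈ I, Integrable (fun ω =>
        ind (P.DegBound B t ω ∧ ∀ x ∈ I.erase j, P.BornJoined x t ω) *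
          ind (P.NewEdge j (t + 1) ω)) P.μ := fun j hj =>
      (((hw t _ (hI' j)).mono (Nat.le_succ t)).mul
        (Weight.ind_event (P.measurableSet_newEdge (hI j hj).2 (t + 1)))).integrable
    calc ∫ ω, ind (P.DegBound B (t + 1) ω ∧ ∀ x ∈ I, P.BornJoined x (t + 1) ω) ∂P.μ
        ≤ ∫ ω, (ind (P.DegBound B t ω ∧ ∀ x ∈ I, P.BornJoined x t ω) +
            ∑ j ∈ I, ind (P.DegBound B t ω ∧ ∀ x ∈ I.erase j, P.BornJoined x t ω) *
              ind (P.NewEdge j (t + 1) ω)) ∂P.μ := by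
          refine integral_mono (hw (t + 1) I hI).integrable
            ((hw t I hI).integrable.add (integrable_finsetSum _ hterm)) fun ω => ?_
          dsimp only
          have hs0 : ∀ j ∈ I,
              0 ≤ ind (P.DegBound B t ω ∧ ∀ x ∈ I.erase j, P.BornJoined x t ω) *
                ind (P.NewEdge j (t + 1) ω) := fun j _ =>
            mul_nonneg (ind_nonneg _) (ind_nonneg _)
          by_cases hω : P.DegBound B (t + 1) ω ∧ ∀ x ∈ I, P.BornJoined x (t + 1) ω
          · rw [ind_pos hω]
            have hD := DegBound.mono P (Nat.le_succ t) hω.1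
            by_cases hj : ∀ x ∈ I, P.BornJoined x t ω
            · rw [ind_pos ⟨hD, hj⟩]
              linarith [Finset.sum_nonneg hs0]
            · push Not at hj
              obtain ⟨j, hjI, hj⟩ := hj
              have hN := ((P.bornJoined_succ j t ω).1 (hω.2 j hjI)).resolve_left hj
              have hrest : ∀ x ∈ I.erase j, P.BornJoined x t ω := fun x hx => by
                refine ((P.bornJoined_succ x t ω).1
                  (hω.2 x (Finset.mem_of_mem_erase hx))).resolve_right fun h => ?_
                exact (Finset.ne_of_mem_erase hx) (NewEdge.eq P (hI' j x hx).1 (hI' j x hx).2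
                  (hI j hjI).1 (hI j hjI).2 (by omega) h hN)
              have h1 := Finset.single_le_sum hs0 hjI
              rw [ind_pos (⟨hD, hrest⟩ : P.DegBound B t ω ∧ _), ind_pos hN, one_mul] at h1
              linarith [ind_nonneg (P.DegBound B t ω ∧ ∀ x ∈ I, P.BornJoined x t ω)]
          · rw [ind_neg hω]
            exact add_nonneg (ind_nonneg _) (Finset.sum_nonneg hs0)
      _ ≤ ∏ x ∈ I, ∑ r ∈ Finset.Ico 1 t, joinRate p B x r + ∑ j ∈ I, joinRate p B j t *
            ∏ x ∈ I.erase j, ∑ r ∈ Finset.Ico 1 t, joinRate p B x r := by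
          rw [integral_add (hw t I hI).integrable (integrable_finsetSum _ hterm),
            integral_finsetSum _ hterm]
          refine add_le_add (ih I hI) (Finset.sum_le_sum fun j hj => ?_)
          refine (P.integral_newEdge_le hp0 hp1 (hI j hj).1 (hI j hj).2 ht (hw t _ (hI' j))
            (fun _ => ind_nonneg _) fun ω hω => ?_).trans
            (mul_le_mul_of_nonneg_left (ih _ (hI' j)) (joinRate_nonneg hB j t))
          by_contra hD
          exact hω (ind_neg fun h => hD h.1)
      _ ≤ _ := by
          refine (prod_add_sum_erase_le I
            (fun x => Finset.sum_nonneg fun r _ => joinRate_nonneg hB x r)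
            fun x => joinRate_nonneg hB x t).trans_eq ?_
          refine Finset.prod_congr rfl fun x _ => ?_
          rw [Finset.sum_Ico_succ_top ht]

theorem sum_Icc_one_div_le {t : ℕ} (ht : 1 ≤ t) :
    ∑ a ∈ Finset.Icc 1 t, 1 / (a : ℝ) ≤ 2 + Real.log t := by
  have h := sum_Ico_one_div_le le_rfl ht
  rw [Nat.cast_one, div_one] at h
  have h1 : Finset.Icc 1 t = Finset.Ico 1 (t + 1) := by ext; simp
  have ht' : (1 : ℝ) ≤ t := by exact_mod_cast ht
  have h2 : 1 / (t : ℝ) ≤ 1 := (div_le_one (by linarith)).2 ht'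
  rw [h1, Finset.sum_Ico_succ_top ht]
  linarith

theorem joinRate_le (hp0 : 0 < p) (hp1 : p < 1) {B : ℝ} (hB : 1 ≤ B) {a b r t : ℕ} (ha : 1 ≤ a)
    (hab : a < b) (hr : 1 ≤ r) (hrt : r ≤ t) :
    joinRate p B (a, b) r ≤ (B ^ 2 * ((a * b : ℝ) ^ (-(1 - p / 2)))) * (t : ℝ) ^ (1 - p) *
      (1 / (r : ℝ) + if b = r + 1 then 1 else 0) := by
  have ha' : (0 : ℝ) < a := by exact_mod_cast ha
  have hb' : (0 : ℝ) < b := by exact_mod_cast (by omega : 0 < b)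
  have hr' : (1 : ℝ) ≤ r := by exact_mod_cast hr
  have hr0 : (0 : ℝ) < r := by linarith
  have hrt' : (r : ℝ) ^ (1 - p) ≤ (t : ℝ) ^ (1 - p) :=
    Real.rpow_le_rpow hr0.le (by exact_mod_cast hrt) (by linarith)
  have hrp : (0 : ℝ) < (r : ℝ) ^ (1 - p) := by positivity
  have e1 : ∀ x : ℝ, 0 < x → ((r : ℝ) / x) ^ (1 - p / 2) =
      (r : ℝ) ^ (1 - p / 2) * x ^ (-(1 - p / 2)) := fun x hx => by
    rw [Real.div_rpow hr0.le hx.le, Real.rpow_neg hx.le, div_eq_mul_inv]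
  have e2 : (r : ℝ) ^ (1 - p / 2) * (r : ℝ) ^ (1 - p / 2) = (r : ℝ) ^ (1 - p) * r := by
    rw [← Real.rpow_add hr0, ← Real.rpow_add_one hr0.ne']
    congr 1; ring
  rw [Real.mul_rpow ha'.le hb'.le]
  set A := (a : ℝ) ^ (-(1 - p / 2)) with hA
  set D := (b : ℝ) ^ (-(1 - p / 2)) with hD
  have hA0 : 0 < A := by positivity
  have hD0 : 0 < D := by positivity
  unfold joinRate
  dsimp only
  split_ifs with h1 h2 h3
  · omega
  · rw [e1 a ha', e1 b hb', ← hA, ← hD, add_zero]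
    calc _ = B ^ 2 * (A * D) * ((r : ℝ) ^ (1 - p / 2) * (r : ℝ) ^ (1 - p / 2)) /
          (2 * (r : ℝ) ^ 2) := by ring
      _ = B ^ 2 * (A * D) * (r : ℝ) ^ (1 - p) * (1 / r) / 2 := by rw [e2]; field_simp
      _ ≤ B ^ 2 * (A * D) * (r : ℝ) ^ (1 - p) * (1 / r) := half_le_self (by positivity)
      _ ≤ _ := by gcongr
  · rw [e1 a ha', ← hA]
    have h4 : 1 ≤ 2 * ((r : ℝ) ^ (1 - p / 2) * D) := by
      rw [hD, ← e1 b hb']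
      have h5 : (2 : ℝ)⁻¹ ≤ r / b := by
        rw [h3, le_div_iff₀ (by positivity)]; push_cast; linarith
      have h6 := Real.rpow_le_rpow (by norm_num) h5 (show 0 ≤ 1 - p / 2 by linarith)
      have h7 : (2 : ℝ)⁻¹ ≤ (2 : ℝ)⁻¹ ^ (1 - p / 2) := by
        conv_lhs => rw [← Real.rpow_one (2 : ℝ)⁻¹]
        exact Real.rpow_le_rpow_of_exponent_ge (by norm_num) (by norm_num) (by linarith)
      linarith
    have hB2 : B ≤ B ^ 2 := by nlinarith
    calc (r : ℝ) ^ (1 - p / 2) * A * B / (2 * r)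
        ≤ (r : ℝ) ^ (1 - p / 2) * A * B / (2 * r) * (2 * ((r : ℝ) ^ (1 - p / 2) * D)) :=
          le_mul_of_one_le_right (by positivity) h4
      _ = A * B * D * ((r : ℝ) ^ (1 - p / 2) * (r : ℝ) ^ (1 - p / 2)) / r := by
          field_simp
      _ = B * (A * D) * (r : ℝ) ^ (1 - p) * 1 := by rw [e2]; field_simp
      _ ≤ B ^ 2 * (A * D) * (t : ℝ) ^ (1 - p) * (1 / r + 1) := by
          have : (0 : ℝ) ≤ 1 / r := by positivity
          gcongr
          linarith
  · have : (0 : ℝ) ≤ 1 / r := by positivity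
    positivity

theorem sum_joinRate_le (hp0 : 0 < p) (hp1 : p < 1) {B : ℝ} (hB : 1 ≤ B) {a b t : ℕ}
    (ha : 1 ≤ a) (hab : a < b) (ht : 1 ≤ t) :
    ∑ r ∈ Finset.Ico 1 t, joinRate p B (a, b) r ≤
      ((2 + Real.log t) * (t : ℝ) ^ (1 - p) * B ^ 2) * (a * b : ℝ) ^ (-(1 - p / 2)) := by
  refine (Finset.sum_le_sum fun r hr => joinRate_le hp0 hp1 hB ha hab
    (Finset.mem_Ico.1 hr).1 (Finset.mem_Ico.1 hr).2.le).trans ?_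
  rw [← Finset.mul_sum, Finset.sum_add_distrib]
  have h1 := sum_Ico_one_div_le le_rfl ht
  rw [Nat.cast_one, div_one] at h1
  have h2 : ∑ r ∈ Finset.Ico 1 t, (if b = r + 1 then (1 : ℝ) else 0) ≤ 1 := by
    calc _ = ∑ r ∈ Finset.Ico 1 t, (if b - 1 = r then (1 : ℝ) else 0) := by
          refine Finset.sum_congr rfl fun r _ => ?_
          simp only [show b = r + 1 ↔ b - 1 = r by omega]
      _ ≤ 1 := by rw [Finset.sum_ite_eq]; split_ifs <;> norm_num
  calc _ ≤ B ^ 2 * (a * b : ℝ) ^ (-(1 - p / 2)) * (t : ℝ) ^ (1 - p) * (2 + Real.log t) :=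
        mul_le_mul_of_nonneg_left (by linarith) (by positivity)
    _ = _ := by ring

/-- The three pairs of birth times of a triple. -/
def pairsOf (q : ℕ × ℕ × ℕ) : Finset (ℕ × ℕ) := {(q.1, q.2.1), (q.1, q.2.2), (q.2.1, q.2.2)}

/-- The increasing triples of elements of `{1, …, t}`. -/
def incTriples (t : ℕ) : Finset (ℕ × ℕ × ℕ) :=
  (Finset.Icc 1 t ×ˢ Finset.Icc 1 t ×ˢ Finset.Icc 1 t).filter fun q => q.1 < q.2.1 ∧ q.2.1 < q.2.2

theorem mem_incTriples {t : ℕ} {q : ℕ × ℕ × ℕ} :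
    q ∈ incTriples t ↔ 1 ≤ q.1 ∧ q.1 < q.2.1 ∧ q.2.1 < q.2.2 ∧ q.2.2 ≤ t := by
  simp only [incTriples, Finset.mem_filter, Finset.mem_product, Finset.mem_Icc]
  omega

theorem integral_triangle_le (hp0 : 0 < p) (hp1 : p < 1) {B : ℝ} (hB : 1 ≤ B) {t : ℕ}
    (ht : 1 ≤ t) {q : ℕ × ℕ × ℕ} (hq : q ∈ incTriples t) :
    ∫ ω, ind (P.DegBound B t ω ∧ ∀ x ∈ pairsOf q, P.BornJoined x t ω) ∂P.μ ≤
      ((2 + Real.log t) * B ^ 2) ^ 3 * (t : ℝ) ^ (3 * ((1 - p) / (2 - p))) *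
        (1 / (q.1 : ℝ) * (1 / (q.2.1 : ℝ) * (1 / (q.2.2 : ℝ)))) := by
  obtain ⟨a, b, c⟩ := q
  rw [mem_incTriples] at hq
  dsimp only at hq ⊢
  obtain ⟨ha, hab, hbc, hct⟩ := hq
  have ha' : (0 : ℝ) < a := by exact_mod_cast ha
  have hb' : (0 : ℝ) < b := by exact_mod_cast (by omega : 0 < b)
  have hc' : (0 : ℝ) < c := by exact_mod_cast (by omega : 0 < c)
  have ht' : (0 : ℝ) < t := by exact_mod_cast ht
  have hlog : 0 ≤ Real.log t := Real.log_nonneg (by exact_mod_cast ht)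
  set I := ∫ ω, ind (P.DegBound B t ω ∧ ∀ x ∈ pairsOf (a, b, c), P.BornJoined x t ω) ∂P.μ
  have hI0 : 0 ≤ I := integral_nonneg fun ω => ind_nonneg _
  have hI1 : I ≤ 1 := by
    calc I ≤ ∫ _, (1 : ℝ) ∂P.μ := integral_mono_of_nonneg
          (Eventually.of_forall fun _ => ind_nonneg _) (integrable_const _)
          (Eventually.of_forall fun _ => ind_le_one _)
      _ = 1 := by simp
  set M := (2 + Real.log t) * (t : ℝ) ^ (1 - p) * B ^ 2 with hM
  have hM0 : 0 ≤ M := by positivity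
  have hI2 : I ≤ (M ^ 3) * ((a * (b * c) : ℝ) ^ (-(2 - p))) := by
    refine (P.integral_bornJoined_le hp0 hp1 (by linarith) ht (pairsOf (a, b, c)) ?_).trans ?_
    · intro x hx
      simp only [pairsOf, Finset.mem_insert, Finset.mem_singleton] at hx
      rcases hx with rfl | rfl | rfl <;> dsimp only <;> omega
    · have hn1 : (a, b) ∉ ({(a, c), (b, c)} : Finset (ℕ × ℕ)) := by
        simp only [Finset.mem_insert, Finset.mem_singleton, Prod.ext_iff]; omega
      have hn2 : (a, c) ∉ ({(b, c)} : Finset (ℕ × ℕ)) := by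
        simp only [Finset.mem_singleton, Prod.ext_iff]; omega
      simp only [pairsOf]
      rw [Finset.prod_insert hn1, Finset.prod_insert hn2, Finset.prod_singleton]
      have s0 : ∀ x, 0 ≤ ∑ r ∈ Finset.Ico 1 t, joinRate p B x r := fun x =>
        Finset.sum_nonneg fun r _ => joinRate_nonneg (by linarith) x r
      have s1 := sum_joinRate_le hp0 hp1 hB ha hab ht
      have s2 := sum_joinRate_le hp0 hp1 hB ha (hab.trans hbc) ht
      have s3 := sum_joinRate_le hp0 hp1 hB (by omega) hbc ht
      refine (mul_le_mul s1 (mul_le_mul s2 s3 (s0 _) (by positivity))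
        (mul_nonneg (s0 _) (s0 _)) (by positivity)).trans_eq ?_
      have e : ∀ x : ℝ, 0 < x → x ^ (-(2 - p)) = x ^ (-(1 - p / 2)) * x ^ (-(1 - p / 2)) :=
        fun x hx => by rw [← Real.rpow_add hx]; congr 1; ring
      rw [Real.mul_rpow (y := (b * c : ℝ)) ha'.le (by positivity), Real.mul_rpow hb'.le hc'.le,
        Real.mul_rpow hb'.le hc'.le, Real.mul_rpow ha'.le hb'.le, Real.mul_rpow ha'.le hc'.le, e a ha', e b hb', e c hc', ← hM]
      ring
  have h2p : 0 < 2 - p := by linarith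
  have hθ0 : 0 ≤ 1 / (2 - p) := by positivity
  have hθ1 : 1 / (2 - p) ≤ 1 := by rw [div_le_one h2p]; linarith
  calc I ≤ I ^ (1 / (2 - p)) := by
        conv_lhs => rw [← Real.rpow_one I]
        exact Real.rpow_le_rpow_of_exponent_ge' hI0 hI1 hθ0 hθ1
    _ ≤ ((M ^ 3) * ((a * (b * c) : ℝ) ^ (-(2 - p)))) ^ (1 / (2 - p)) :=
        Real.rpow_le_rpow hI0 hI2 hθ0
    _ = (((2 + Real.log t) * B ^ 2) ^ 3) ^ (1 / (2 - p)) *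
          (t : ℝ) ^ (3 * ((1 - p) / (2 - p))) * (1 / (a * (b * c))) := by
        rw [Real.mul_rpow (by positivity) (by positivity),
          ← Real.rpow_mul (by positivity) (-(2 - p))]
        have e1 : M ^ 3 = ((2 + Real.log t) * B ^ 2) ^ 3 * ((t : ℝ) ^ (1 - p)) ^ 3 := by
          rw [hM]; ring
        have e2 : -(2 - p) * (1 / (2 - p)) = -1 := by field_simp
        rw [e1, Real.mul_rpow (by positivity) (by positivity), e2, Real.rpow_neg_one,
          ← Real.rpow_natCast ((t : ℝ) ^ (1 - p)) 3, ← Real.rpow_mul ht'.le,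
          ← Real.rpow_mul ht'.le, one_div (_ * _)]
        congr 3
        push_cast
        ring
    _ ≤ ((2 + Real.log t) * B ^ 2) ^ 3 * (t : ℝ) ^ (3 * ((1 - p) / (2 - p))) *
          (1 / (a * (b * c))) := by
        gcongr
        conv_rhs => rw [← Real.rpow_one (((2 + Real.log t) * B ^ 2) ^ 3)]
        refine Real.rpow_le_rpow_of_exponent_le (one_le_pow₀ ?_) hθ1
        have : 1 ≤ B ^ 2 := one_le_pow₀ hB
        nlinarith
    _ = _ := by field_simp

theorem triangles_le {t : ℕ} (ht : 1 ≤ t) (ω : P.Ω) :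
    (P.triangles t ω : ℝ) ≤
      ∑ q ∈ incTriples t, ind (∀ x ∈ pairsOf q, P.BornJoined x t ω) := by
  have hex : ∀ i, ∃ a, 1 ≤ i → i ≤ P.nv t ω → a ∈ Finset.Icc 1 t ∧ P.bornAt a ω = i := by
    intro i
    by_cases h : 1 ≤ i ∧ i ≤ P.nv t ω
    · obtain ⟨a, ha⟩ := P.exists_bornAt_eq ht ω h.1 h.2
      exact ⟨a, fun _ _ => ha⟩
    · exact ⟨0, fun h1 h2 => absurd ⟨h1, h2⟩ h⟩
  choose f hf using hex
  have hmem : ∀ {i j}, P.Joined t i j ω →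
      (1 ≤ i ∧ i ≤ P.nv t ω) ∧ (1 ≤ j ∧ j ≤ P.nv t ω) := by
    rintro i j ⟨s, hs, h⟩
    rw [Finset.mem_Icc] at hs
    have h1 := P.ep_mem hs.1 ω
    have h2 := P.nv_mono hs.1 hs.2 ω
    rcases h with h | h <;> simp only [h] at h1 <;> omega
  have hlt : ∀ {i j}, 1 ≤ i → i < j → j ≤ P.nv t ω → f i < f j := by
    intro i j hi hij hj
    obtain ⟨i1, i2⟩ := hf i hi (by omega)
    obtain ⟨j1, j2⟩ := hf j (by omega) hj
    rw [Finset.mem_Icc] at i1 j1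
    by_contra hle
    rcases (not_lt.1 hle).lt_or_eq with h | h
    · have := P.bornAt_lt j1.1 h (by omega : P.bornAt (f i) ω ≠ 0)
      have := P.bornAt_le (f j) ω
      omega
    · rw [h] at j2; omega
  have hjoin : ∀ {i j}, i < j → P.Joined t i j ω → P.BornJoined (f i, f j) t ω := by
    intro i j hij hJ
    obtain ⟨⟨hi, hi'⟩, hj, hj'⟩ := hmem hJ
    obtain ⟨s, hs, h⟩ := hJ
    obtain ⟨-, i2⟩ := hf i hi hi'
    obtain ⟨j1, j2⟩ := hf j hj hj'
    refine ⟨s, hs, ?_, by simpa only [i2, j2] using h⟩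
    rw [Finset.mem_Icc] at hs
    by_contra hle
    dsimp only at hle
    have h3 := P.bornAt_lt hs.1 (not_le.1 hle) (by omega : P.bornAt (f j) ω ≠ 0)
    have h1 := P.ep_mem hs.1 ω
    rcases h with h | h <;> simp only [h] at h1 <;> omega
  have hcard : P.triangles t ω ≤ ((incTriples t).filter
      fun q => ∀ x ∈ pairsOf q, P.BornJoined x t ω).card := by
    refine Finset.card_le_card_of_injOn (fun q => (f q.1, f q.2.1, f q.2.2)) ?_ ?_
    · rintro ⟨i, j, k⟩ hq
      simp only [Finset.coe_filter, Set.mem_ofPred_eq] at hq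
      obtain ⟨-, hij, hjk, h1, h2, h3⟩ := hq
      have m1 := hmem h1
      have m2 := hmem h2
      simp only [Finset.coe_filter, Set.mem_ofPred_eq, mem_incTriples]
      refine ⟨⟨(Finset.mem_Icc.1 (hf i m1.1.1 m1.1.2).1).1, hlt m1.1.1 hij m1.2.2,
        hlt m1.2.1 hjk m2.2.2, (Finset.mem_Icc.1 (hf k m2.2.1 m2.2.2).1).2⟩, ?_⟩
      intro x hx
      simp only [pairsOf, Finset.mem_insert, Finset.mem_singleton] at hx
      rcases hx with rfl | rfl | rfl
      · exact hjoin hij h1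
      · exact hjoin (hij.trans hjk) h2
      · exact hjoin hjk h3
    · rintro ⟨i, j, k⟩ hq ⟨i', j', k'⟩ hq' h
      simp only [Finset.coe_filter, Set.mem_ofPred_eq] at hq hq'
      have m1 := hmem hq.2.2.2.1
      have m2 := hmem hq.2.2.2.2.1
      have m1' := hmem hq'.2.2.2.1
      have m2' := hmem hq'.2.2.2.2.1
      simp only [Prod.mk.injEq] at h ⊢
      refine ⟨?_, ?_, ?_⟩
      · rw [← (hf i m1.1.1 m1.1.2).2, ← (hf i' m1'.1.1 m1'.1.2).2, h.1]
      · rw [← (hf j m1.2.1 m1.2.2).2, ← (hf j' m1'.2.1 m1'.2.2).2, h.2.1]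
      · rw [← (hf k m2.2.1 m2.2.2).2, ← (hf k' m2'.2.1 m2'.2.2).2, h.2.2]
  refine (Nat.cast_le.2 hcard).trans_eq ?_
  rw [Finset.card_filter]
  push_cast
  exact Finset.sum_congr rfl fun q _ => by unfold ind; congr

theorem measure_triangles_gt_le (hp0 : 0 < p) (hp1 : p < 1) {B : ℝ} (hB : 1 ≤ B) {t : ℕ}
    (ht : 1 ≤ t) {x : ℝ} (hx : 0 < x) :
    P.μ.real {ω | P.DegBound B t ω ∧ x ≤ P.triangles t ω} ≤
      ((2 + Real.log t) ^ 6 * B ^ 6 * (t : ℝ) ^ (3 * ((1 - p) / (2 - p)))) / x := by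
  have hlog : 0 ≤ Real.log t := Real.log_nonneg (by exact_mod_cast ht)
  have hw : ∀ q ∈ incTriples t, Integrable
      (fun ω => ind (P.DegBound B t ω ∧ ∀ x ∈ pairsOf q, P.BornJoined x t ω)) P.μ := by
    intro q hq
    rw [mem_incTriples] at hq
    have h : MeasurableSet[P.ℱ t] {ω | ∀ x ∈ pairsOf q, P.BornJoined x t ω} := by
      simp only [Set.ofPred_forall]
      refine Finset.measurableSet_biInter _ fun x hx => P.measurableSet_bornJoined ?_ t
      simp only [pairsOf, Finset.mem_insert, Finset.mem_singleton] at hx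
      rcases hx with rfl | rfl | rfl <;> dsimp only <;> omega
    exact (Weight.ind_event ((P.measurableSet_degBound B t).inter h)).integrable
  set T : P.Ω → ℝ := fun ω => ∑ q ∈ incTriples t,
    ind (P.DegBound B t ω ∧ ∀ x ∈ pairsOf q, P.BornJoined x t ω) with hT
  have hTi : Integrable T P.μ := integrable_finsetSum _ hw
  have hT0 : ∀ ω, 0 ≤ T ω := fun ω => Finset.sum_nonneg fun _ _ => ind_nonneg _
  have hsub : {ω | P.DegBound B t ω ∧ x ≤ P.triangles t ω} ⊆ {ω | x ≤ T ω} := by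
    rintro ω ⟨hD, hω⟩
    refine (hω.trans (P.triangles_le ht ω)).trans_eq ?_
    refine Finset.sum_congr rfl fun q _ => ?_
    rw [ind_and, ind_pos hD, one_mul]
  refine (measureReal_mono hsub (measure_ne_top _ _)).trans ?_
  rw [le_div_iff₀ hx, mul_comm]
  refine (mul_meas_ge_le_integral_of_nonneg (Eventually.of_forall hT0) hTi x).trans ?_
  rw [hT, integral_finsetSum _ hw]
  refine (Finset.sum_le_sum fun q hq => P.integral_triangle_le hp0 hp1 hB ht hq).trans ?_
  rw [← Finset.mul_sum]
  have h1 : ∑ q ∈ incTriples t, (1 / (q.1 : ℝ) * (1 / (q.2.1 : ℝ) * (1 / (q.2.2 : ℝ)))) ≤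
      (2 + Real.log t) ^ 3 := by
    calc _ ≤ ∑ q ∈ Finset.Icc 1 t ×ˢ Finset.Icc 1 t ×ˢ Finset.Icc 1 t,
          (1 / (q.1 : ℝ) * (1 / (q.2.1 : ℝ) * (1 / (q.2.2 : ℝ)))) :=
          Finset.sum_le_sum_of_subset_of_nonneg (Finset.filter_subset _ _)
            fun _ _ _ => by positivity
      _ = (∑ a ∈ Finset.Icc 1 t, 1 / (a : ℝ)) ^ 3 := by
          rw [Finset.sum_product, pow_three, Finset.sum_mul]
          refine Finset.sum_congr rfl fun a _ => ?_
          rw [Finset.sum_product, Finset.sum_mul, Finset.mul_sum]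
          refine Finset.sum_congr rfl fun b _ => ?_
          dsimp only
          rw [Finset.mul_sum, Finset.mul_sum]
      _ ≤ _ := pow_le_pow_left₀ (Finset.sum_nonneg fun _ _ => by positivity)
          (sum_Icc_one_div_le ht) 3
  refine (mul_le_mul_of_nonneg_left h1 (by positivity)).trans_eq ?_
  ring

/-- The times `s ≤ t` at which the added edge is incident to the vertex `i`. -/
noncomputable def incTimes (t i : ℕ) (ω : P.Ω) : Finset ℕ :=
  (Finset.Icc 1 t).filter fun s => (P.ep s ω).1 = i ∨ (P.ep s ω).2 = i

theorem card_incTimes_le (t i : ℕ) (ω : P.Ω) : (P.incTimes t i ω).card ≤ P.deg t i ω := by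
  rw [incTimes, Finset.card_filter, deg, degOf]
  refine Finset.sum_le_sum fun s _ => ?_
  split_ifs <;> simp_all

theorem deg_le_card_incTimes (t i : ℕ) (ω : P.Ω) :
    P.deg t i ω ≤ 2 * (P.incTimes t i ω).card := by
  rw [incTimes, Finset.card_filter, Finset.mul_sum, deg, degOf]
  refine Finset.sum_le_sum fun s _ => ?_
  split_ifs <;> simp_all

theorem cherries_le {t : ℕ} (ht : 1 ≤ t) (ω : P.Ω) :
    P.cherries t ω ≤ ∑ a ∈ Finset.Icc 1 t, P.deg t (P.bornAt a ω) ω ^ 2 := by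
  have hsub : (Finset.Icc 1 t ×ˢ Finset.Icc 1 t).filter (fun q => q.1 < q.2 ∧
      ((P.ep q.1 ω).1 = (P.ep q.2 ω).1 ∨ (P.ep q.1 ω).1 = (P.ep q.2 ω).2 ∨
       (P.ep q.1 ω).2 = (P.ep q.2 ω).1 ∨ (P.ep q.1 ω).2 = (P.ep q.2 ω).2)) ⊆
      (Finset.Icc 1 t).biUnion fun a =>
        P.incTimes t (P.bornAt a ω) ω ×ˢ P.incTimes t (P.bornAt a ω) ω := by
    rintro ⟨r, s⟩ hq
    simp only [Finset.mem_filter, Finset.mem_product] at hq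
    obtain ⟨⟨hr, hs⟩, -, h⟩ := hq
    obtain ⟨v, hv, hvt, h1, h2⟩ : ∃ v, 1 ≤ v ∧ v ≤ P.nv t ω ∧
        ((P.ep r ω).1 = v ∨ (P.ep r ω).2 = v) ∧ ((P.ep s ω).1 = v ∨ (P.ep s ω).2 = v) := by
      have hr' := Finset.mem_Icc.1 hr
      have h1 := P.ep_mem hr'.1 ω
      have h2 := P.nv_mono hr'.1 hr'.2 ω
      rcases h with h | h | h | h
      · exact ⟨(P.ep r ω).1, by omega, by omega, by omega, by omega⟩
      · exact ⟨(P.ep r ω).1, by omega, by omega, by omega, by omega⟩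
      · exact ⟨(P.ep r ω).2, by omega, by omega, by omega, by omega⟩
      · exact ⟨(P.ep r ω).2, by omega, by omega, by omega, by omega⟩
    obtain ⟨a, ha, rfl⟩ := P.exists_bornAt_eq ht ω hv hvt
    simp only [Finset.mem_biUnion, Finset.mem_product, incTimes, Finset.mem_filter]
    exact ⟨a, ha, ⟨hr, h1⟩, hs, h2⟩
  refine (Finset.card_le_card hsub).trans (Finset.card_biUnion_le.trans ?_)
  refine Finset.sum_le_sum fun a _ => ?_
  rw [Finset.card_product, ← pow_two]
  exact Nat.pow_le_pow_left (P.card_incTimes_le t _ ω) 2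

theorem DegBound.cherries_le {B : ℝ} (hp1 : p < 1) {t : ℕ} (ht : 1 ≤ t) {ω : P.Ω}
    (h : P.DegBound B t ω) :
    (P.cherries t ω : ℝ) ≤ B ^ 2 * (t : ℝ) ^ (2 - p) * (2 + Real.log t) := by
  have ht' : (0 : ℝ) < t := by exact_mod_cast ht
  have h1 : (P.cherries t ω : ℝ) ≤
      ∑ a ∈ Finset.Icc 1 t, (P.deg t (P.bornAt a ω) ω : ℝ) ^ 2 := by
    exact_mod_cast P.cherries_le ht ω
  refine h1.trans ?_
  calc _ ≤ ∑ a ∈ Finset.Icc 1 t, B ^ 2 * (t : ℝ) ^ (2 - p) * (1 / (a : ℝ)) := by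
        refine Finset.sum_le_sum fun a ha => ?_
        have h2 := h t (by simp; omega) a ha
        have ha1 : (1 : ℝ) ≤ a := by exact_mod_cast (Finset.mem_Icc.1 ha).1
        have ha0 : (0 : ℝ) < a := by linarith
        refine (pow_le_pow_left₀ (Nat.cast_nonneg _) h2 2).trans ?_
        rw [mul_pow, ← Real.rpow_natCast, ← Real.rpow_mul (by positivity),
          Real.div_rpow ht'.le ha0.le]
        have e : (1 - p / 2) * ((2 : ℕ) : ℝ) = 2 - p := by push_cast; ring
        rw [e]
        have h3 : (a : ℝ) ≤ (a : ℝ) ^ (2 - p) := by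
          conv_lhs => rw [← Real.rpow_one (a : ℝ)]
          exact Real.rpow_le_rpow_of_exponent_le ha1 (by linarith)
        calc (t : ℝ) ^ (2 - p) / (a : ℝ) ^ (2 - p) * B ^ 2
            ≤ (t : ℝ) ^ (2 - p) / a * B ^ 2 := by gcongr
          _ = _ := by ring
    _ ≤ _ := by
        rw [← Finset.mul_sum]
        exact mul_le_mul_of_nonneg_left (sum_Icc_one_div_le ht) (by positivity)

theorem card_mul_card_sub_one_le (S : Finset ℕ) :
    S.card * S.card - S.card ≤ 2 * ((S ×ˢ S).filter fun q => q.1 < q.2).card := by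
  rw [← Finset.offDiag_card]
  have h : S.offDiag ⊆ (S ×ˢ S).filter (fun q => q.1 < q.2) ∪
      ((S ×ˢ S).filter fun q => q.1 < q.2).image Prod.swap := by
    rintro ⟨a, b⟩ hq
    rw [Finset.mem_offDiag] at hq
    simp only [Finset.mem_union, Finset.mem_filter, Finset.mem_product, Finset.mem_image,
      Prod.exists, Prod.swap_prod_mk, Prod.mk.injEq]
    rcases Nat.lt_or_gt_of_ne hq.2.2 with h | h
    · exact .inl ⟨⟨hq.1, hq.2.1⟩, h⟩
    · exact .inr ⟨b, a, ⟨⟨hq.2.1, hq.1⟩, h⟩, rfl, rfl⟩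
  refine (Finset.card_le_card h).trans ((Finset.card_union_le _ _).trans ?_)
  have := Finset.card_image_le (s := (S ×ˢ S).filter fun q => q.1 < q.2) (f := Prod.swap)
  omega

theorem deg_sq_le_cherries (t i : ℕ) (ω : P.Ω) (h : 4 ≤ P.deg t i ω) :
    P.deg t i ω ^ 2 ≤ 16 * P.cherries t ω := by
  have h1 := P.deg_le_card_incTimes t i ω
  have h2 := card_mul_card_sub_one_le (P.incTimes t i ω)
  have h3 : ((P.incTimes t i ω ×ˢ P.incTimes t i ω).filter fun q => q.1 < q.2).card ≤
      P.cherries t ω := by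
    refine Finset.card_le_card ?_
    rintro ⟨r, s⟩ hq
    simp only [Finset.mem_filter, Finset.mem_product, incTimes] at hq ⊢
    exact ⟨⟨hq.1.1.1, hq.1.2.1⟩, hq.2, by omega⟩
  set m := (P.incTimes t i ω).card
  have hm : 2 ≤ m := by omega
  have h4 : m * m ≤ 2 * (m * m - m) := by
    have : 2 * m ≤ m * m := Nat.mul_le_mul_right m hm
    omega
  nlinarith

/-- The function `h` with `d * h (d + 1) = (d - 1 / 2) * h d`, `h 0 = 0` and `h 1 = 1`, which is
of order `d ^ (- 1 / 2)`. -/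
noncomputable def invSqrtLike : ℕ → ℝ
  | 0 => 0
  | d + 1 => ∏ k ∈ Finset.range d, (1 - 1 / (2 * ((k : ℝ) + 1)))

theorem invSqrtLike_succ_succ (d : ℕ) :
    invSqrtLike (d + 2) = invSqrtLike (d + 1) * (1 - 1 / (2 * ((d : ℝ) + 1))) := by
  simp only [invSqrtLike, Finset.prod_range_succ]

theorem invSqrtLike_mem (d : ℕ) : 0 ≤ invSqrtLike d ∧ invSqrtLike d ≤ 1 := by
  rcases d with _ | d
  · simp [invSqrtLike]
  · have h : ∀ k : ℕ, 0 ≤ 1 / (2 * ((k : ℝ) + 1)) ∧ 1 / (2 * ((k : ℝ) + 1)) ≤ 1 := fun k => by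
      refine ⟨by positivity, ?_⟩
      rw [div_le_one (by positivity)]
      have := k.cast_nonneg (α := ℝ)
      linarith
    exact ⟨Finset.prod_nonneg fun k _ => by linarith [h k],
      Finset.prod_le_one (fun k _ => by linarith [h k]) fun k _ => by linarith [h k]⟩

theorem mul_invSqrtLike_succ (d : ℕ) :
    d * invSqrtLike (d + 1) = (d + (-(1 / 2))) * invSqrtLike d := by
  rcases d with _ | d
  · simp [invSqrtLike]
  · rw [invSqrtLike_succ_succ]
    push_cast
    field_simp
    ring

theorem le_invSqrtLike_sq (d : ℕ) : 1 / (4 * ((d : ℝ) + 1)) ≤ invSqrtLike (d + 2) ^ 2 := by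
  induction d with
  | zero => norm_num [invSqrtLike]
  | succ d ih =>
    rw [invSqrtLike_succ_succ, mul_pow]
    refine le_trans ?_ (mul_le_mul_of_nonneg_right ih (sq_nonneg _))
    push_cast
    have hd := d.cast_nonneg (α := ℝ)
    rw [show (1 - 1 / (2 * ((d : ℝ) + 1 + 1))) = (2 * d + 3) / (2 * (d + 2)) by
      field_simp; ring, div_pow, div_mul_div_comm, div_le_div_iff₀ (by positivity) (by positivity)]
    nlinarith

theorem one_div_sqrt_le_invSqrtLike {d : ℕ} (hd : 1 ≤ d) {D : ℝ} (hD : (d : ℝ) ≤ D) :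
    1 / (2 * √D) ≤ invSqrtLike d := by
  have hd' : (1 : ℝ) ≤ d := by exact_mod_cast hd
  refine le_of_sq_le_sq ?_ (invSqrtLike_mem d).1
  rw [div_pow, mul_pow, Real.sq_sqrt (by linarith)]
  have h1 : 1 ^ 2 / (2 ^ 2 * D) ≤ 1 / (4 * (d : ℝ)) := by
    norm_num only
    gcongr
  refine h1.trans ?_
  rcases d with _ | _ | d
  · simp at hd
  · norm_num [invSqrtLike]
  · refine le_trans ?_ (le_invSqrtLike_sq d)
    push_cast
    gcongr
    linarith

theorem exists_measure_deg_le (hp0 : 0 < p) (hp1 : p < 1) :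
    ∃ C : ℝ, 0 ≤ C ∧ ∀ (s t i : ℕ) (D : ℝ), 1 ≤ i → 1 ≤ s → s ≤ t → 0 < D →
      P.μ.real {ω | i ≤ P.nv s ω ∧ (P.deg t i ω : ℝ) ≤ D} ≤
        C * √D * ((t : ℝ) / s) ^ (-((1 - p / 2) / 2)) := by
  set κ : ℝ := -(1 / 2) with hκ
  refine ⟨2 * Real.exp (|κ| + 2 * |κ ^ 2 - κ|), by positivity, fun s t i D hi hs hst hD => ?_⟩
  set u : P.Ω → ℕ := fun ω => if i ≤ P.nv s ω then i else 0 with hu'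
  have hu : Measurable[P.ℱ s] u :=
    Measurable.ite (measurableSet_le measurable_const (P.nv_meas s)) measurable_const
      measurable_const
  have hun : ∀ ω, u ω ≤ P.nv s ω := fun ω => by simp only [hu']; split_ifs <;> omega
  have h := P.integral_comp_deg_le_rpow (κ := κ) hp0 hp1 hs hst (fun d => (invSqrtLike_mem d).1)
    mul_invSqrtLike_succ (Weight.const 1) (fun _ => zero_le_one) hu hun
  simp only [one_mul] at h
  have h1 : ∫ ω, invSqrtLike (P.deg s (u ω) ω) ∂P.μ ≤ 1 := by
    calc _ ≤ ∫ _, (1 : ℝ) ∂P.μ := integral_mono (Weight.comp_deg _ hu).integrable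
          (integrable_const _) fun ω => (invSqrtLike_mem _).2
      _ = 1 := by simp
  have hsub : {ω | i ≤ P.nv s ω ∧ (P.deg t i ω : ℝ) ≤ D} ⊆
      {ω | 1 / (2 * √D) ≤ invSqrtLike (P.deg t (u ω) ω)} := by
    rintro ω ⟨h2, h3⟩
    simp only [Set.mem_ofPred_eq, hu', h2, if_true]
    exact one_div_sqrt_le_invSqrtLike
      (P.one_le_deg (hs.trans hst) ω hi (h2.trans (P.nv_mono hs hst ω))) h3
  refine (measureReal_mono hsub (measure_ne_top _ _)).trans ?_
  have h4 := mul_meas_ge_le_integral_of_nonneg (μ := P.μ)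
    (f := fun ω => invSqrtLike (P.deg t (u ω) ω))
    (Eventually.of_forall fun ω => (invSqrtLike_mem _).1)
    (Weight.comp_deg _ (hu.mono (P.ℱ.mono hst) le_rfl)).integrable (1 / (2 * √D))
  have hs' : (0 : ℝ) < s := by exact_mod_cast hs
  have ht' : (0 : ℝ) < t := by exact_mod_cast hs.trans hst
  have hsq : 0 < √D := Real.sqrt_pos.2 hD
  have e : κ * (1 - p / 2) = -((1 - p / 2) / 2) := by rw [hκ]; ring
  rw [e] at h
  have h5 := h4.trans (h.trans (mul_le_of_le_one_right (by positivity) h1))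
  rw [div_mul_eq_mul_div, one_mul, div_le_iff₀ (by positivity)] at h5
  exact h5.trans_eq (by ring)

theorem integral_half_pow_nv (hp1 : p < 1) {t : ℕ} (ht : 1 ≤ t) :
    ∫ ω, (1 / 2 : ℝ) ^ P.nv t ω ∂P.μ ≤ (1 - p / 2) ^ t := by
  have hw : ∀ t, P.Weight t fun ω => (1 / 2 : ℝ) ^ P.nv t ω := fun t =>
    ⟨(measurable_from_nat (f := fun n : ℕ => (1 / 2 : ℝ) ^ n)).comp (P.nv_meas t), 1, fun ω => by
      rw [abs_of_nonneg (by positivity)]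
      exact pow_le_one₀ (by norm_num) (by norm_num)⟩
  induction t, ht using Nat.le_induction with
  | base => simp only [P.nv_one]; simp; linarith
  | succ t ht ih =>
    have hZ := P.measurableSet_Z (t + 1) true
    have h1 : ∀ ω, (1 / 2 : ℝ) ^ P.nv (t + 1) ω = (1 / 2 : ℝ) ^ P.nv t ω -
        1 / 2 * ((1 / 2 : ℝ) ^ P.nv t ω * ind (P.Z (t + 1) ω = true)) := fun ω => by
      rw [P.nv_succ t ht]
      split_ifs with h
      · rw [ind_pos h, pow_succ]; ring
      · rw [ind_neg h]; simp
    have h2 := P.integral_mul_ind (hw t) (P.ℱ.le _ _ hZ) (P.condLaw_Z t ht)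
    have hi := (((hw t).mono (Nat.le_succ t)).mul (Weight.ind_event hZ)).integrable
    simp only [h1]
    rw [integral_sub (hw t).integrable (hi.const_mul _), integral_const_mul, h2,
      integral_mul_const, pow_succ]
    nlinarith [mul_le_mul_of_nonneg_right ih (show 0 ≤ 1 - p / 2 by linarith)]

theorem measure_nv_lt_le (hp1 : p < 1) {s : ℕ} (hs : 1 ≤ s) (n : ℕ) :
    P.μ.real {ω | P.nv s ω < n} ≤ 2 ^ n * (1 - p / 2) ^ s := by
  have hsub : {ω | P.nv s ω < n} ⊆ {ω | (1 / 2 : ℝ) ^ n ≤ (1 / 2 : ℝ) ^ P.nv s ω} :=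
    fun ω hω => pow_le_pow_of_le_one (a := (1 / 2 : ℝ)) (by norm_num) (by norm_num) (le_of_lt hω)
  refine (measureReal_mono hsub (measure_ne_top _ _)).trans ?_
  have hi : Integrable (fun ω => (1 / 2 : ℝ) ^ P.nv s ω) P.μ := by
    have : P.Weight s fun ω => (1 / 2 : ℝ) ^ P.nv s ω :=
      ⟨(measurable_from_nat (f := fun n : ℕ => (1 / 2 : ℝ) ^ n)).comp (P.nv_meas s), 1,
        fun ω => by
          rw [abs_of_nonneg (by positivity)]
          exact pow_le_one₀ (by norm_num) (by norm_num)⟩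
    exact this.integrable
  have h := (mul_meas_ge_le_integral_of_nonneg (μ := P.μ)
    (Eventually.of_forall fun ω => by positivity) hi ((1 / 2 : ℝ) ^ n)).trans
    (P.integral_half_pow_nv hp1 hs)
  rw [one_div, inv_pow, inv_mul_le_iff₀ (by positivity)] at h
  simpa [one_div] using h

theorem measurableSet_joined (t i j : ℕ) : MeasurableSet[P.ℱ t] {ω | P.Joined t i j ω} := by
  have h : {ω | P.Joined t i j ω} = ⋃ s ∈ Finset.Icc 1 t,
      ({ω | P.ep s ω = (i, j)} ∪ {ω | P.ep s ω = (j, i)}) := by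
    ext ω; simp [Joined]
  rw [h]
  refine Finset.measurableSet_biUnion _ fun s hs => P.ℱ.mono (Finset.mem_Icc.1 hs).2 _ ?_
  exact (P.measurableSet_ep_eq measurable_const measurable_const).union
    (P.measurableSet_ep_eq measurable_const measurable_const)

theorem Joined.mono {s t i j : ℕ} (hst : s ≤ t) {ω : P.Ω} (h : P.Joined s i j ω) :
    P.Joined t i j ω := by
  obtain ⟨r, hr, h⟩ := h
  exact ⟨r, Finset.Icc_subset_Icc_right hst hr, h⟩

theorem integral_not_joined_le (hp1 : p < 1) {h t i j : ℕ} (hh : 1 ≤ h) (hht : h ≤ t) {D : ℝ}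
    (hD : 0 ≤ D) {T : ℝ} (hT : t ≤ T) :
    ∫ ω, ind (¬P.Joined t i j ω ∧ D ≤ P.deg h i ω ∧ D ≤ P.deg h j ω) ∂P.μ ≤
      Real.exp (-((1 - p) * D ^ 2 / (2 * T) ^ 2 * (t - h : ℕ))) := by
  set y := (1 - p) * D ^ 2 / (2 * T) ^ 2 with hy
  have hw : ∀ t, h ≤ t → P.Weight t fun ω =>
      ind (¬P.Joined t i j ω ∧ D ≤ P.deg h i ω ∧ D ≤ P.deg h j ω) := by
    intro t hht
    have hd : ∀ k, MeasurableSet[P.ℱ t] {ω | D ≤ (P.deg h k ω : ℝ)} := fun k =>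
      P.ℱ.mono hht _ (measurableSet_le measurable_const
        ((measurable_from_nat (f := fun d : ℕ => (d : ℝ))).comp
          (P.measurable_deg measurable_const)))
    exact Weight.ind_event ((P.measurableSet_joined t i j).compl.inter ((hd i).inter (hd j)))
  induction t, hht using Nat.le_induction with
  | base =>
    simp only [Nat.sub_self, Nat.cast_zero, mul_zero, neg_zero, Real.exp_zero]
    calc _ ≤ ∫ _, (1 : ℝ) ∂P.μ := integral_mono (hw h le_rfl).integrable
          (integrable_const _) fun ω => ind_le_one _
      _ = 1 := by simp
  | succ t hht ih =>
    have ht1 : 1 ≤ t := hh.trans hht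
    have ht0 : (0 : ℝ) < t := by exact_mod_cast ht1
    push_cast at hT
    have hE := P.measurableSet_edgeStep (t := t) (u := fun _ => i) (v := fun _ => j)
      measurable_const measurable_const
    set W : P.Ω → ℝ := fun ω =>
      ind (¬P.Joined t i j ω ∧ D ≤ P.deg h i ω ∧ D ≤ P.deg h j ω) with hW
    have hWE : Integrable (fun ω => W ω * ind (P.Z (t + 1) ω = false ∧
        P.ep (t + 1) ω = (i, j))) P.μ :=
      (((hw t hht).mono (Nat.le_succ t)).mul (Weight.ind_event hE)).integrable
    have key : y * ∫ ω, W ω ∂P.μ ≤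
        ∫ ω, W ω * ind (P.Z (t + 1) ω = false ∧ P.ep (t + 1) ω = (i, j)) ∂P.μ := by
      rw [P.integral_edgeStep ht1 (hw t hht) (u := fun _ => i) (v := fun _ => j)
        measurable_const measurable_const, ← integral_const_mul]
      have hdd := (((hw t hht).mul (Weight.const ((1 - p) / (2 * (t : ℝ)) ^ 2))).mul
        ((Weight.comp_deg (fun d => (d : ℝ)) (P := P) (t := t) (u := fun _ => i)
          measurable_const).mul (Weight.comp_deg (fun d => (d : ℝ)) (P := P) (t := t)
            (u := fun _ => j) measurable_const))).integrable
      refine integral_mono ((hw t hht).integrable.const_mul y)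
        (hdd.congr (Eventually.of_forall fun ω => by dsimp only; ring)) fun ω => ?_
      dsimp only
      by_cases hω : ¬P.Joined t i j ω ∧ D ≤ P.deg h i ω ∧ D ≤ P.deg h j ω
      · simp only [hW, ind_pos hω, one_mul, mul_one]
        have d1 : (P.deg h i ω : ℝ) ≤ P.deg t i ω := Nat.cast_le.2 (P.deg_mono i ω hht)
        have d2 : (P.deg h j ω : ℝ) ≤ P.deg t j ω := Nat.cast_le.2 (P.deg_mono j ω hht)
        have d3 : D * D ≤ P.deg t i ω * P.deg t j ω :=
          mul_le_mul (hω.2.1.trans d1) (hω.2.2.trans d2) hD (by positivity)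
        rw [hy, mul_assoc (1 - p), pow_two D]
        have : 0 ≤ 1 - p := by linarith
        have : (t : ℝ) ≤ T := by linarith
        gcongr
      · simp [hW, ind_neg hω]
    calc _ ≤ ∫ ω, (W ω - W ω * ind (P.Z (t + 1) ω = false ∧ P.ep (t + 1) ω = (i, j))) ∂P.μ := by
          refine integral_mono (hw (t + 1) (by omega)).integrable
            ((hw t hht).integrable.sub hWE) fun ω => ?_
          dsimp only
          by_cases hω : ¬P.Joined (t + 1) i j ω ∧ D ≤ P.deg h i ω ∧ D ≤ P.deg h j ω
          · have hω' : ¬P.Joined t i j ω ∧ D ≤ P.deg h i ω ∧ D ≤ P.deg h j ω :=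
              ⟨fun hJ => hω.1 (Joined.mono P (Nat.le_succ t) hJ), hω.2⟩
            have hN : ¬(P.Z (t + 1) ω = false ∧ P.ep (t + 1) ω = (i, j)) := fun hN =>
              hω.1 ⟨t + 1, by simp, .inl hN.2⟩
            simp only [hW, ind_pos hω, ind_pos hω', ind_neg hN]
            norm_num
          · rw [ind_neg hω, ← mul_one_sub]
            exact mul_nonneg (ind_nonneg _) (by linarith [ind_le_one (P.Z (t + 1) ω = false ∧
              P.ep (t + 1) ω = (i, j))])
      _ ≤ (1 - y) * ∫ ω, W ω ∂P.μ := by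
          rw [integral_sub (hw t hht).integrable hWE]; linarith
      _ ≤ Real.exp (-y) * Real.exp (-(y * (t - h : ℕ))) := by
          refine mul_le_mul ?_ (ih (by linarith)) (integral_nonneg fun _ => ind_nonneg _)
            (Real.exp_nonneg _)
          linarith [Real.add_one_le_exp (-y)]
      _ = _ := by
          rw [← Real.exp_add, Nat.succ_sub hht]
          push_cast
          congr 1
          ring

theorem measureReal_eq_integral_ind {t : ℕ} {A : P.Ω → Prop}
    (hA : MeasurableSet[P.ℱ t] {ω | A ω}) : P.μ.real {ω | A ω} = ∫ ω, ind (A ω) ∂P.μ := by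
  rw [← integral_indicator_one (P.ℱ.le t _ hA)]
  refine integral_congr_ae (Eventually.of_forall fun ω => ?_)
  by_cases h : A ω <;> simp [ind, Set.indicator, h]

theorem exists_measure_not_joined_le (hp0 : 0 < p) (hp1 : p < 1) :
    ∃ C : ℝ, 0 ≤ C ∧ ∀ (s h t i j : ℕ) (D : ℝ), 1 ≤ i → 1 ≤ j → 1 ≤ s → s ≤ h → h < t → 0 < D →
      P.μ.real {ω | (i ≤ P.nv s ω ∧ j ≤ P.nv s ω) ∧ ¬P.Joined t i j ω} ≤
        C * (√D * ((h : ℝ) / s) ^ (-((1 - p / 2) / 2)) + t ^ 2 / (D ^ 2 * (t - h : ℕ))) := by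
  obtain ⟨C, hC, hCd⟩ := P.exists_measure_deg_le hp0 hp1
  refine ⟨2 * C + 4 / (1 - p), by have : 0 < 1 - p := by linarith
                                  positivity,
    fun s h t i j D hi hj hs hsh hht hD => ?_⟩
  have hq : 0 < 1 - p := by linarith
  have ht : (0 : ℝ) < t := by exact_mod_cast (by omega : 0 < t)
  have hth : (0 : ℝ) < (t - h : ℕ) := by exact_mod_cast (by omega : 0 < t - h)
  have hsub : {ω | (i ≤ P.nv s ω ∧ j ≤ P.nv s ω) ∧ ¬P.Joined t i j ω} ⊆
      ({ω | i ≤ P.nv s ω ∧ (P.deg h i ω : ℝ) ≤ D} ∪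
        {ω | j ≤ P.nv s ω ∧ (P.deg h j ω : ℝ) ≤ D}) ∪
        {ω | ¬P.Joined t i j ω ∧ D ≤ P.deg h i ω ∧ D ≤ P.deg h j ω} := by
    rintro ω ⟨h1, h2⟩
    rcases le_total (P.deg h i ω : ℝ) D with h3 | h3
    · exact .inl (.inl ⟨h1.1, h3⟩)
    · rcases le_total (P.deg h j ω : ℝ) D with h4 | h4
      · exact .inl (.inr ⟨h1.2, h4⟩)
      · exact .inr ⟨h2, h3, h4⟩
  have u := (measureReal_mono (μ := P.μ) hsub (measure_ne_top _ _)).trans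
    ((measureReal_union_le _ _).trans (add_le_add (measureReal_union_le _ _) le_rfl))
  have m1 := hCd s h i D hi hs hsh hD
  have m2 := hCd s h j D hj hs hsh hD
  have m3 : P.μ.real {ω | ¬P.Joined t i j ω ∧ D ≤ P.deg h i ω ∧ D ≤ P.deg h j ω} ≤
      4 / (1 - p) * (t ^ 2 / (D ^ 2 * (t - h : ℕ))) := by
    have hd : ∀ k, MeasurableSet[P.ℱ t] {ω | D ≤ (P.deg h k ω : ℝ)} := fun k =>
      P.ℱ.mono hht.le _ (measurableSet_le measurable_const
        ((measurable_from_nat (f := fun d : ℕ => (d : ℝ))).comp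
          (P.measurable_deg measurable_const)))
    rw [P.measureReal_eq_integral_ind (t := t)
      (A := fun ω => ¬P.Joined t i j ω ∧ D ≤ P.deg h i ω ∧ D ≤ P.deg h j ω)
      ((P.measurableSet_joined t i j).compl.inter ((hd i).inter (hd j)))]
    refine (P.integral_not_joined_le hp1 (hs.trans hsh) hht.le hD.le le_rfl).trans ?_
    set z := (1 - p) * D ^ 2 / (2 * (t : ℝ)) ^ 2 * (t - h : ℕ) with hz
    have hz0 : 0 < z := by positivity
    have e : 4 / (1 - p) * (t ^ 2 / (D ^ 2 * (t - h : ℕ))) = z⁻¹ := by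
      rw [hz]; field_simp; ring
    rw [e, Real.exp_neg]
    exact inv_anti₀ hz0 (by linarith [Real.add_one_le_exp z])
  have p1 : 0 ≤ √D * ((h : ℝ) / s) ^ (-((1 - p / 2) / 2)) := by positivity
  have p2 : (0 : ℝ) ≤ t ^ 2 / (D ^ 2 * (t - h : ℕ)) := by positivity
  have p3 : 0 ≤ 4 / (1 - p) := by positivity
  nlinarith [mul_nonneg hC p2, mul_nonneg p3 p1]

theorem card_incTriples_ge (m : ℕ) : m ^ 3 ≤ (incTriples (3 * m)).card := by
  have h : Finset.Icc 1 m ×ˢ Finset.Icc (m + 1) (2 * m) ×ˢ Finset.Icc (2 * m + 1) (3 * m) ⊆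
      incTriples (3 * m) := by
    rintro ⟨a, b, c⟩ hq
    simp only [Finset.mem_product, Finset.mem_Icc] at hq
    rw [mem_incTriples]
    dsimp only
    omega
  refine le_of_eq_of_le ?_ (Finset.card_le_card h)
  simp only [Finset.card_product, Nat.card_Icc]
  rw [show m + 1 - 1 = m by omega, show 2 * m + 1 - (m + 1) = m by omega,
    show 3 * m + 1 - (2 * m + 1) = m by omega]
  ring

theorem measure_triangles_lt_le {s t n : ℕ} (hst : s ≤ t) (hnt : n ≤ t) {b : ℝ}
    (hb0 : 0 ≤ b) (hn : 3 ≤ n)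
    (hb : ∀ i j, 1 ≤ i → i < j → j ≤ n →
      P.μ.real {ω | (i ≤ P.nv s ω ∧ j ≤ P.nv s ω) ∧ ¬P.Joined t i j ω} ≤ b) :
    P.μ.real {ω | n ≤ P.nv s ω ∧ 2 * P.triangles t ω < (incTriples n).card} ≤ 6 * b := by
  set Bad : ℕ × ℕ → P.Ω → Prop := fun x ω => n ≤ P.nv s ω ∧ ¬P.Joined t x.1 x.2 ω with hBad
  have hmB : ∀ x, MeasurableSet[P.ℱ t] {ω | Bad x ω} := fun x =>
    (P.ℱ.mono hst _ (measurableSet_le measurable_const (P.nv_meas s))).inter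
      (P.measurableSet_joined t x.1 x.2).compl
  have hiB : ∀ x, Integrable (fun ω => ind (Bad x ω)) P.μ := fun x =>
    (Weight.ind_event (hmB x)).integrable
  set N : P.Ω → ℝ := fun ω => ∑ q ∈ incTriples n, ∑ x ∈ pairsOf q, ind (Bad x ω) with hN
  have hNi : Integrable N P.μ :=
    integrable_finsetSum _ fun q _ => integrable_finsetSum _ fun x _ => hiB x
  have hN0 : ∀ ω, 0 ≤ N ω := fun ω =>
    Finset.sum_nonneg fun _ _ => Finset.sum_nonneg fun _ _ => ind_nonneg _
  have hcard : (0 : ℝ) < (incTriples n).card := by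
    exact_mod_cast Finset.card_pos.2 ⟨(1, 2, 3), mem_incTriples.2 (by dsimp only; omega)⟩
  have hEN : ∫ ω, N ω ∂P.μ ≤ (incTriples n).card * (3 * b) := by
    rw [hN, integral_finsetSum _ fun q _ => integrable_finsetSum _ fun x _ => hiB x,
      ← nsmul_eq_mul]
    refine Finset.sum_le_card_nsmul _ _ _ fun q hq => ?_
    rw [integral_finsetSum _ fun x _ => hiB x]
    have h3 : (pairsOf q).card ≤ 3 := Finset.card_le_three
    have h4 : ∑ x ∈ pairsOf q, ∫ ω, ind (Bad x ω) ∂P.μ ≤ (pairsOf q).card • b := by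
      refine Finset.sum_le_card_nsmul _ _ _ fun x hx => ?_
      have hx' : 1 ≤ x.1 ∧ x.1 < x.2 ∧ x.2 ≤ n := by
        rw [mem_incTriples] at hq
        simp only [pairsOf, Finset.mem_insert, Finset.mem_singleton] at hx
        rcases hx with rfl | rfl | rfl <;> dsimp only <;> omega
      rw [← P.measureReal_eq_integral_ind (hmB x)]
      refine (measureReal_mono ?_ (measure_ne_top _ _)).trans
        (hb x.1 x.2 hx'.1 hx'.2.1 hx'.2.2)
      rintro ω ⟨h1, h2⟩
      exact ⟨⟨by omega, by omega⟩, h2⟩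
    refine h4.trans ?_
    rw [nsmul_eq_mul]
    exact mul_le_mul_of_nonneg_right (by exact_mod_cast h3) hb0
  have hsub : {ω | n ≤ P.nv s ω ∧ 2 * P.triangles t ω < (incTriples n).card} ⊆
      {ω | ((incTriples n).card : ℝ) / 2 ≤ N ω} := by
    rintro ω ⟨hω, hlt⟩
    have h1 : (incTriples n).filter (fun q => ¬∃ x ∈ pairsOf q, Bad x ω) ⊆
        (Finset.Icc 1 t ×ˢ Finset.Icc 1 t ×ˢ Finset.Icc 1 t).filter
          (fun q => q.1 < q.2.1 ∧ q.2.1 < q.2.2 ∧ P.Joined t q.1 q.2.1 ω ∧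
            P.Joined t q.1 q.2.2 ω ∧ P.Joined t q.2.1 q.2.2 ω) := by
      rintro ⟨a, b, c⟩ hq
      simp only [Finset.mem_filter, mem_incTriples, pairsOf, Finset.mem_insert,
        Finset.mem_singleton, exists_eq_or_imp, exists_eq_left, hBad, hω, true_and, not_or,
        not_not] at hq
      simp only [Finset.mem_filter, Finset.mem_product, Finset.mem_Icc]
      exact ⟨by omega, hq.1.2.1, hq.1.2.2.1, hq.2.1, hq.2.2.1, hq.2.2.2⟩
    have h2 : ((incTriples n).filter fun q => ¬∃ x ∈ pairsOf q, Bad x ω).card ≤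
        P.triangles t ω := Finset.card_le_card h1
    have h3 := Finset.card_filter_add_card_filter_not (s := incTriples n)
      (p := fun q => ∃ x ∈ pairsOf q, Bad x ω)
    have h4 : (((incTriples n).filter fun q => ∃ x ∈ pairsOf q, Bad x ω).card : ℝ) ≤ N ω := by
      rw [Finset.card_filter]
      push_cast
      refine Finset.sum_le_sum fun q _ => ?_
      split_ifs with hq
      · obtain ⟨x, hx, hxB⟩ := hq
        have := Finset.single_le_sum (f := fun x => ind (Bad x ω)) (fun x _ => ind_nonneg _) hx
        rwa [ind_pos hxB] at this
      · exact Finset.sum_nonneg fun _ _ => ind_nonneg _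
    refine le_trans ?_ h4
    rw [div_le_iff₀ two_pos]
    have h5 : (incTriples n).card ≤
        ((incTriples n).filter fun q => ∃ x ∈ pairsOf q, Bad x ω).card * 2 := by omega
    exact_mod_cast h5
  refine (measureReal_mono hsub (measure_ne_top _ _)).trans ?_
  have h := (mul_meas_ge_le_integral_of_nonneg (μ := P.μ) (Eventually.of_forall hN0) hNi
    ((incTriples n).card / 2 : ℝ)).trans hEN
  refine le_of_mul_le_mul_left (h.trans_eq ?_) (half_pos hcard)
  ring

theorem tendsto_natCast_rpow_zero {a : ℝ} (ha : a < 0) :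
    Tendsto (fun t : ℕ => (t : ℝ) ^ a) atTop (nhds 0) := by
  have h := (tendsto_rpow_neg_atTop (neg_pos.2 ha)).comp (tendsto_natCast_atTop_atTop (R := ℝ))
  simpa [Function.comp_def] using h

theorem eventually_const_le_rpow (C : ℝ) {δ : ℝ} (hδ : 0 < δ) :
    ∀ᶠ t : ℕ in atTop, C ≤ (t : ℝ) ^ δ :=
  ((tendsto_rpow_atTop hδ).comp (tendsto_natCast_atTop_atTop (R := ℝ))).eventually_ge_atTop C

theorem eventually_two_add_log_le_rpow {δ : ℝ} (hδ : 0 < δ) :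
    ∀ᶠ t : ℕ in atTop, 2 + Real.log t ≤ (t : ℝ) ^ δ := by
  have h := (isLittleO_log_rpow_atTop hδ).bound (show (0 : ℝ) < 1 / 2 by norm_num)
  filter_upwards [(tendsto_natCast_atTop_atTop (R := ℝ)).eventually h,
    eventually_const_le_rpow 4 hδ] with t h1 h2
  rw [Real.norm_of_nonneg (by positivity : 0 ≤ (t : ℝ) ^ δ)] at h1
  linarith [(Real.le_norm_self _).trans h1]

theorem tendsto_measure_zero_of_subset {A A₁ A₂ : ℕ → Set P.Ω}
    (h₁ : Tendsto (fun t => P.μ.real (A₁ t)) atTop (nhds 0))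
    (h₂ : Tendsto (fun t => P.μ.real (A₂ t)) atTop (nhds 0))
    (h : ∀ᶠ t in atTop, A t ⊆ A₁ t ∪ A₂ t) :
    Tendsto (fun t => P.μ.real (A t)) atTop (nhds 0) := by
  refine squeeze_zero' (Eventually.of_forall fun t => measureReal_nonneg) ?_
    (by simpa using h₁.add h₂)
  filter_upwards [h] with t ht
  exact (measureReal_mono ht (measure_ne_top _ _)).trans (measureReal_union_le _ _)

theorem tendsto_measure_one_of_compl {A : ℕ → Set P.Ω}
    (h : Tendsto (fun t => P.μ.real (A t)ᶜ) atTop (nhds 0)) :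
    Tendsto (fun t => P.μ (A t)) atTop (nhds 1) := by
  refine (ENNReal.tendsto_toReal_iff (fun _ => measure_ne_top _ _) ENNReal.one_ne_top).1 ?_
  rw [ENNReal.toReal_one]
  refine tendsto_of_tendsto_of_tendsto_of_le_of_le (by simpa using h.const_sub 1)
    tendsto_const_nhds (fun t => ?_) fun t => measureReal_le_one
  have h1 := measureReal_union_le (μ := P.μ) (A t) (A t)ᶜ
  rw [Set.union_compl_self, probReal_univ] at h1
  change 1 - P.μ.real (A t)ᶜ ≤ P.μ.real (A t)
  linarith

theorem tendsto_not_degBound (hp0 : 0 < p) (hp1 : p < 1) {δ : ℝ} (hδ : 0 < δ) :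
    Tendsto (fun t : ℕ => P.μ.real {ω | ¬P.DegBound ((t : ℝ) ^ δ) t ω}) atTop (nhds 0) := by
  obtain ⟨k, hk⟩ := exists_nat_ge (3 / δ)
  obtain ⟨C, hC, h⟩ := P.exists_measure_not_degBound_le hp0 hp1 k
  rw [div_le_iff₀ hδ] at hk
  refine squeeze_zero' (Eventually.of_forall fun t => measureReal_nonneg) ?_
    (by simpa using (tendsto_natCast_rpow_zero (show (-1 : ℝ) < 0 by norm_num)).const_mul C)
  filter_upwards [eventually_ge_atTop 1] with t ht
  have ht1 : (1 : ℝ) ≤ t := by exact_mod_cast ht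
  have ht0 : (0 : ℝ) < t := by linarith
  refine (h t _ (by positivity)).trans (le_of_eq_of_le ?_ (mul_le_mul_of_nonneg_left
    (Real.rpow_le_rpow_of_exponent_le ht1 (show 2 - δ * k ≤ -1 by linarith)) hC))
  rw [Real.rpow_sub ht0, Real.rpow_mul ht0.le, Real.rpow_natCast, Real.rpow_two]
  ring

theorem tendsto_measure_triangles_gt (hp0 : 0 < p) (hp1 : p < 1) {δ : ℝ} (hδ : 0 < δ) :
    Tendsto (fun t : ℕ => P.μ.real
      {ω | (t : ℝ) ^ (3 * ((1 - p) / (2 - p)) + 13 * δ) < P.triangles t ω}) atTop (nhds 0) := by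
  set a := 3 * ((1 - p) / (2 - p)) with ha
  refine P.tendsto_measure_zero_of_subset (P.tendsto_not_degBound hp0 hp1 hδ)
    (A₂ := fun t => {ω | P.DegBound ((t : ℝ) ^ δ) t ω ∧ (t : ℝ) ^ (a + 13 * δ) ≤ P.triangles t ω})
    ?_ (Eventually.of_forall fun t ω hω => ?_)
  · refine squeeze_zero' (Eventually.of_forall fun t => measureReal_nonneg) ?_
      (tendsto_natCast_rpow_zero (show -δ < 0 by linarith))
    filter_upwards [eventually_ge_atTop 1, eventually_two_add_log_le_rpow hδ] with t ht hlog
    have ht1 : (1 : ℝ) ≤ t := by exact_mod_cast ht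
    have ht0 : (0 : ℝ) < t := by linarith
    refine (P.measure_triangles_gt_le hp0 hp1 (Real.one_le_rpow ht1 hδ.le) ht
      (by positivity)).trans ?_
    rw [← ha, div_le_iff₀ (by positivity)]
    have hl0 := Real.log_nonneg ht1
    calc _ ≤ ((t : ℝ) ^ δ) ^ 6 * ((t : ℝ) ^ δ) ^ 6 * (t : ℝ) ^ a := by gcongr
      _ = _ := by
        rw [← pow_add, ← Real.rpow_natCast, ← Real.rpow_mul ht0.le, ← Real.rpow_add ht0,
          ← Real.rpow_add ht0]
        congr 1
        push_cast
        ring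
  · by_cases hd : P.DegBound ((t : ℝ) ^ δ) t ω
    · exact .inr ⟨hd, le_of_lt hω⟩
    · exact .inl hd

theorem tendsto_measure_cherries_gt (hp0 : 0 < p) (hp1 : p < 1) {δ : ℝ} (hδ : 0 < δ) :
    Tendsto (fun t : ℕ => P.μ.real
      {ω | (t : ℝ) ^ (2 - p + 3 * δ) < P.cherries t ω}) atTop (nhds 0) := by
  have h := P.tendsto_not_degBound hp0 hp1 hδ
  refine P.tendsto_measure_zero_of_subset h h ?_
  filter_upwards [eventually_ge_atTop 1, eventually_two_add_log_le_rpow hδ] with t ht hlog ω hω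
  rw [Set.union_self]
  have ht0 : (0 : ℝ) < t := by exact_mod_cast ht
  intro hd
  refine absurd (hω.trans_le ((DegBound.cherries_le P hp1 ht hd).trans
    (mul_le_mul_of_nonneg_left hlog (by positivity)))) (not_lt.2 (le_of_eq ?_))
  rw [← Real.rpow_natCast, ← Real.rpow_mul ht0.le, ← Real.rpow_add ht0, ← Real.rpow_add ht0]
  congr 1
  push_cast
  ring

theorem tendsto_measure_cherries_lt (hp0 : 0 < p) (hp1 : p < 1) {δ : ℝ} (hδ : 0 < δ)
    (hδp : δ < 1 - p / 2) :
    Tendsto (fun t : ℕ => P.μ.real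
      {ω | (P.cherries t ω : ℝ) < (t : ℝ) ^ (2 - p - 2 * δ) / 16}) atTop (nhds 0) := by
  obtain ⟨C, hC, h⟩ := P.exists_measure_deg_le hp0 hp1
  refine squeeze_zero' (Eventually.of_forall fun t => measureReal_nonneg) ?_
    (by simpa using (tendsto_natCast_rpow_zero (show -(δ / 2) < 0 by linarith)).const_mul C)
  filter_upwards [eventually_ge_atTop 1, eventually_const_le_rpow 4 (sub_pos.2 hδp)] with t ht h4
  have ht0 : (0 : ℝ) < t := by exact_mod_cast ht
  have hsub : {ω | (P.cherries t ω : ℝ) < (t : ℝ) ^ (2 - p - 2 * δ) / 16} ⊆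
      {ω | 1 ≤ P.nv 1 ω ∧ (P.deg t 1 ω : ℝ) ≤ (t : ℝ) ^ (1 - p / 2 - δ)} := by
    intro ω hω
    refine ⟨(P.nv_one ω).ge, le_of_not_gt fun hd => ?_⟩
    have h1 : (P.deg t 1 ω : ℝ) ^ 2 ≤ 16 * P.cherries t ω := by
      exact_mod_cast P.deg_sq_le_cherries t 1 ω (by exact_mod_cast h4.trans hd.le)
    have h2 : ((t : ℝ) ^ (1 - p / 2 - δ)) ^ 2 = (t : ℝ) ^ (2 - p - 2 * δ) := by
      rw [← Real.rpow_natCast, ← Real.rpow_mul ht0.le]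
      congr 1
      push_cast
      ring
    have h3 := pow_le_pow_left₀ (by positivity) hd.le 2
    have h5 : (P.cherries t ω : ℝ) < (t : ℝ) ^ (2 - p - 2 * δ) / 16 := hω
    linarith
  refine (measureReal_mono hsub (measure_ne_top _ _)).trans
    ((h 1 t 1 _ le_rfl le_rfl ht (by positivity)).trans (le_of_eq ?_))
  rw [Nat.cast_one, div_one, Real.sqrt_eq_rpow, ← Real.rpow_mul ht0.le, mul_assoc,
    ← Real.rpow_add ht0]
  congr 2
  ring

theorem tendsto_measure_triangles_lt (hp0 : 0 < p) (hp1 : p < 1) {δ : ℝ} (hδ : 0 < δ)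
    (hδp : δ < (1 - p) / (2 - p)) :
    Tendsto (fun t : ℕ => P.μ.real
      {ω | (P.triangles t ω : ℝ) < (t : ℝ) ^ (3 * ((1 - p) / (2 - p)) - 3 * δ) / 2})
      atTop (nhds 0) := by
  set α := (1 - p) / (2 - p) with hα
  set β := α - δ with hβ
  set c := 1 - p / 2 with hc
  have hc0 : 0 < c := by linarith
  have hcα : c * (1 - α) = 1 / 2 := by
    have : 2 - p ≠ 0 := by linarith
    rw [hc, hα]; field_simp; ring
  have hα1 : α < 1 := by
    by_contra hcon
    nlinarith [mul_nonneg hc0.le (sub_nonneg.2 (not_lt.1 hcon))]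
  have hβ0 : 0 < β := sub_pos.2 hδp
  obtain ⟨K, hK⟩ := exists_pow_lt_of_lt_one (show (0 : ℝ) < 1 / 4 by norm_num)
    (show c < 1 by linarith)
  have hK1 : 1 ≤ K := by
    rcases Nat.eq_zero_or_pos K with rfl | h
    · norm_num at hK
    · exact h
  have hK0 : (0 : ℝ) < K := by exact_mod_cast hK1
  obtain ⟨C, hC, hJ⟩ := P.exists_measure_not_joined_le hp0 hp1
  set m : ℕ → ℕ := fun t => ⌈(t : ℝ) ^ β⌉₊ with hm
  have hm1 : ∀ t : ℕ, (t : ℝ) ^ β ≤ m t := fun t => Nat.le_ceil _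
  have hm2 : ∀ t : ℕ, 1 ≤ t → (m t : ℝ) ≤ 2 * (t : ℝ) ^ β := fun t ht => by
    have h1 := Real.one_le_rpow (show (1 : ℝ) ≤ t by exact_mod_cast ht) hβ0.le
    linarith [Nat.ceil_lt_add_one (by linarith : 0 ≤ (t : ℝ) ^ β)]
  have hm0 : ∀ t : ℕ, 1 ≤ t → 1 ≤ m t := fun t ht =>
    Nat.ceil_pos.2 (Real.rpow_pos_of_pos (by exact_mod_cast ht) _)
  have hfew : Tendsto (fun t => P.μ.real {ω | P.nv (K * (3 * m t)) ω < 3 * m t})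
      atTop (nhds 0) := by
    refine squeeze_zero' (Eventually.of_forall fun t => measureReal_nonneg) ?_
      (tendsto_natCast_rpow_zero (neg_neg_of_pos hβ0))
    filter_upwards [eventually_ge_atTop 1] with t ht
    have hmt := hm0 t ht
    refine (P.measure_nv_lt_le hp1 (Nat.mul_pos hK1 (by omega)) _).trans ?_
    have ht0 : (0 : ℝ) < t := by exact_mod_cast ht
    rw [pow_mul (1 - p / 2), ← mul_pow]
    have h1 : (2 * (1 - p / 2) ^ K) ^ (3 * m t) ≤ (1 / 2 : ℝ) ^ (3 * m t) :=
      pow_le_pow_left₀ (by positivity) (by linarith) _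
    refine h1.trans ?_
    rw [one_div, inv_pow, Real.rpow_neg ht0.le]
    refine inv_anti₀ (by positivity) ((hm1 t).trans ?_)
    exact_mod_cast (show m t ≤ 3 * m t by omega).trans Nat.lt_two_pow_self.le
  set b : ℕ → ℝ := fun t => C * ((18 * K) ^ (c / 2) * (t : ℝ) ^ (-(c * δ / 4)) +
    2 * (t : ℝ) ^ (-(c * δ))) with hb
  have hb0 : ∀ t, 0 ≤ b t := fun t => by positivity
  have hbl : Tendsto (fun t => 6 * b t) atTop (nhds 0) := by
    have h1 := tendsto_natCast_rpow_zero (show -(c * δ / 4) < 0 by linarith [mul_pos hc0 hδ])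
    have h2 := tendsto_natCast_rpow_zero (show -(c * δ) < 0 by linarith [mul_pos hc0 hδ])
    simpa using (((h1.const_mul ((18 * (K : ℝ)) ^ (c / 2))).add (h2.const_mul 2)).const_mul C).const_mul 6
  refine P.tendsto_measure_zero_of_subset hfew
    (A₂ := fun t => {ω | 3 * m t ≤ P.nv (K * (3 * m t)) ω ∧
      2 * P.triangles t ω < (incTriples (3 * m t)).card}) ?_ ?_
  · refine squeeze_zero' (Eventually.of_forall fun t => measureReal_nonneg) ?_ hbl
    filter_upwards [eventually_ge_atTop 2,
      eventually_const_le_rpow (18 * K) (show 0 < 1 - β by linarith)] with t ht hKt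
    have hmt := hm0 t (by omega)
    have hm2t := hm2 t (by omega)
    have ht0 : (0 : ℝ) < t := by exact_mod_cast (by omega : 0 < t)
    have hh1 : (t : ℝ) / 3 ≤ (t / 2 : ℕ) := by
      rw [div_le_iff₀ (by norm_num)]
      exact_mod_cast (by omega : t ≤ t / 2 * 3)
    have hh2 : (t : ℝ) / 2 ≤ (t - t / 2 : ℕ) := by
      rw [div_le_iff₀ (by norm_num)]
      exact_mod_cast (by omega : t ≤ (t - t / 2) * 2)
    have hs6 : ((K * (3 * m t) : ℕ) : ℝ) ≤ 6 * K * (t : ℝ) ^ β := by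
      push_cast
      nlinarith
    have hprod : (t : ℝ) ^ (1 - β) * (t : ℝ) ^ β = t := by
      rw [← Real.rpow_add ht0]; simp
    have hsh : K * (3 * m t) ≤ t / 2 := by
      have : ((K * (3 * m t) : ℕ) : ℝ) ≤ (t / 2 : ℕ) := by
        nlinarith [mul_le_mul_of_nonneg_right hKt (by positivity : 0 ≤ (t : ℝ) ^ β)]
      exact_mod_cast this
    have hns : 3 * m t ≤ K * (3 * m t) := Nat.le_mul_of_pos_left _ hK1
    refine P.measure_triangles_lt_le (by omega) (by omega) (hb0 t) (by omega)
      fun i j hi hij hj => ?_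
    refine (hJ (K * (3 * m t)) (t / 2) t i j ((t : ℝ) ^ (1 / 2 + c * δ / 2)) hi (by omega)
      (by omega) hsh (by omega) (by positivity)).trans ?_
    refine mul_le_mul_of_nonneg_left (add_le_add ?_ ?_) hC
    · have hs0 : (0 : ℝ) < (K * (3 * m t) : ℕ) := by exact_mod_cast (by omega)
      have hratio : (t : ℝ) ^ (1 - β) / (18 * K) ≤ (t / 2 : ℕ) / (K * (3 * m t) : ℕ) := by
        rw [div_le_div_iff₀ (by positivity) hs0]
        have := mul_le_mul_of_nonneg_left hs6 (by positivity : 0 ≤ (t : ℝ) ^ (1 - β))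
        nlinarith
      have h1 := Real.rpow_le_rpow_of_nonpos (by positivity) hratio
        (show -(c / 2) ≤ 0 by linarith)
      refine (mul_le_mul_of_nonneg_left h1 (Real.sqrt_nonneg _)).trans (le_of_eq ?_)
      rw [Real.div_rpow (by positivity) (by positivity), Real.rpow_neg (by positivity : 0 ≤ 18 * (K:ℝ)),
        div_inv_eq_mul, Real.sqrt_eq_rpow, ← Real.rpow_mul ht0.le, ← Real.rpow_mul ht0.le,
        ← mul_assoc, ← Real.rpow_add ht0, mul_comm]
      congr 2
      rw [hβ]
      linear_combination (-1 / 2 : ℝ) * hcα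
    · rw [div_le_iff₀ (mul_pos (by positivity) (by linarith))]
      have h1 : (t : ℝ) ^ 2 = 2 * (t : ℝ) ^ (-(c * δ)) *
          (((t : ℝ) ^ (1 / 2 + c * δ / 2)) ^ 2 * (t / 2)) := by
        have : (t : ℝ) ^ (-(c * δ)) * ((t : ℝ) ^ (1 / 2 + c * δ / 2)) ^ 2 = t := by
          rw [← Real.rpow_natCast, ← Real.rpow_mul ht0.le, ← Real.rpow_add ht0]
          conv_rhs => rw [← Real.rpow_one (t : ℝ)]
          congr 1
          push_cast
          ring
        linear_combination (-(t : ℝ)) * this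
      rw [h1]
      gcongr
  · filter_upwards [eventually_ge_atTop 1] with t ht ω hω
    rcases lt_or_ge (P.nv (K * (3 * m t)) ω) (3 * m t) with h | h
    · exact .inl h
    refine .inr ⟨h, ?_⟩
    have h1 : ((m t : ℝ)) ^ 3 ≤ (incTriples (3 * m t)).card := by
      exact_mod_cast card_incTriples_ge (m t)
    have h2 : (t : ℝ) ^ (3 * α - 3 * δ) = ((t : ℝ) ^ β) ^ 3 := by
      rw [← Real.rpow_natCast, ← Real.rpow_mul (Nat.cast_nonneg t)]
      congr 1
      rw [hβ]
      push_cast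
      ring
    have h3 := pow_le_pow_left₀ (by positivity) (hm1 t) 3
    have h4 : (P.triangles t ω : ℝ) < (t : ℝ) ^ (3 * α - 3 * δ) / 2 := hω
    have h5 : 2 * (P.triangles t ω : ℝ) < (incTriples (3 * m t)).card := by linarith
    exact_mod_cast h5

end PAProcess

/-- **Theorem (Global clustering coefficient).**
For `p ∈ (0,1)` and `γ(p) = 2 - p - 3(1-p)/(2-p)`, for every `0 < ε < 1` there are positive
constants `C₁, C₂` (depending only on `ε` and `p`) such that
`P(C₁ t^{-γ(p)(1+ε)} ≤ τ(G_t) ≤ C₂ t^{-γ(p)(1-ε)}) = 1 - o(1)` as `t → ∞`. -/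
theorem global_clustering_coefficient (p : ℝ) (hp0 : 0 < p) (hp1 : p < 1)
    (P : PAProcess p) (ε : ℝ) (hε0 : 0 < ε) (hε1 : ε < 1) :
    ∃ C₁ C₂ : ℝ, 0 < C₁ ∧ 0 < C₂ ∧
      Tendsto
        (fun t : ℕ => P.μ {ω |
          C₁ * (t : ℝ) ^ (-((2 - p - 3 * (1 - p) / (2 - p)) * (1 + ε))) ≤ P.clustering t ω ∧
          P.clustering t ω ≤ C₂ * (t : ℝ) ^ (-((2 - p - 3 * (1 - p) / (2 - p)) * (1 - ε)))})
        atTop (nhds 1) := by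
  rw [mul_div_assoc]
  set α := (1 - p) / (2 - p) with hα
  have h2p : 0 < 2 - p := by linarith
  have hα0 : 0 < α := div_pos (by linarith) h2p
  set γ := 2 - p - 3 * α with hγ
  have hγ0 : 0 < γ := by
    have h : γ = ((p - 1 / 2) ^ 2 + 3 / 4) / (2 - p) := by
      rw [hγ, hα]; field_simp; ring
    rw [h]; positivity
  obtain ⟨δ, hδ0, hδγ, hδα, hδc⟩ : ∃ δ, 0 < δ ∧ 15 * δ ≤ γ * ε ∧ δ < α ∧ δ < 1 - p / 2 := by
    refine ⟨min (γ * ε / 15) (min (α / 2) (1 / 4)), by positivity, ?_, ?_, ?_⟩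
    · linarith [min_le_left (γ * ε / 15) (min (α / 2) (1 / 4))]
    · linarith [min_le_right (γ * ε / 15) (min (α / 2) (1 / 4)), min_le_left (α / 2) (1 / 4)]
    · linarith [min_le_right (γ * ε / 15) (min (α / 2) (1 / 4)), min_le_right (α / 2) (1 / 4)]
  refine ⟨3 / 2, 48, by norm_num, by norm_num, ?_⟩
  refine P.tendsto_measure_one_of_compl (P.tendsto_measure_zero_of_subset
    (P.tendsto_measure_zero_of_subset (P.tendsto_measure_triangles_gt hp0 hp1 hδ0)
      (P.tendsto_measure_cherries_gt hp0 hp1 hδ0) (.of_forall fun _ => subset_rfl))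
    (P.tendsto_measure_zero_of_subset (P.tendsto_measure_cherries_lt hp0 hp1 hδ0 hδc)
      (P.tendsto_measure_triangles_lt hp0 hp1 hδ0 hδα) (.of_forall fun _ => subset_rfl)) ?_)
  filter_upwards [eventually_ge_atTop 1] with t ht ω hω
  have ht1 : (1 : ℝ) ≤ t := by exact_mod_cast ht
  have ht0 : (0 : ℝ) < t := by linarith
  by_contra hcon
  simp only [Set.mem_union, Set.mem_ofPred_eq, not_or, not_lt] at hcon
  obtain ⟨⟨u1, u2⟩, u3, u4⟩ := hcon
  have hc0 : (0 : ℝ) < P.cherries t ω := lt_of_lt_of_le (by positivity) u3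
  refine hω ⟨?_, ?_⟩
  · rw [PAProcess.clustering, le_div_iff₀ hc0]
    have h1 : (t : ℝ) ^ (-(γ * (1 + ε))) * (t : ℝ) ^ (2 - p + 3 * δ) ≤
        (t : ℝ) ^ (3 * α - 3 * δ) := by
      rw [← Real.rpow_add ht0]
      exact Real.rpow_le_rpow_of_exponent_le ht1 (by rw [hγ] at hδγ ⊢; linarith)
    have h2 := mul_le_mul_of_nonneg_left u2
      (by positivity : 0 ≤ (t : ℝ) ^ (-(γ * (1 + ε))))
    linarith
  · rw [PAProcess.clustering, div_le_iff₀ hc0]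
    have h1 : (t : ℝ) ^ (3 * α + 13 * δ) ≤
        (t : ℝ) ^ (-(γ * (1 - ε))) * (t : ℝ) ^ (2 - p - 2 * δ) := by
      rw [← Real.rpow_add ht0]
      exact Real.rpow_le_rpow_of_exponent_le ht1 (by rw [hγ] at hδγ ⊢; linarith)
    have h2 := mul_le_mul_of_nonneg_left u3
      (by positivity : 0 ≤ (t : ℝ) ^ (-(γ * (1 - ε))))
    linarith
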